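/- arXiv:math/0103093 — 2 statements merged into one kernel-verified Lean document; each statement's English description precedes it below -/
import Mathlib

section
/- Let n ≥ 2 and let H ≥ 1, ε > 0 be real numbers. Let 𝒩(ε,H) be the number of points P ∈ ℙ(M_n(ℚ)) of Northcott–Schmidt height at most H with μ(P) ≥ 1/ε, and let 𝒩(1,H) be the total number of points of ℙ(M_n(ℚ)) of height at most H. Then, provided H > C(n), 𝒩(ε,H)/𝒩(1,H) ≤ ε·n^{5/2} + B(ε,n)/(H − C(n)), where B(ε,n) := ζ(n²)·[(T_n + ε·n^{5/2})·𝔖^{(n²)}/(K_{n²}·ζ(n²−1)) + 2ε·n^{5/2} + 2/K_{n²}] and C(n) := ζ(n²)·[𝔖^{(n²)}/(K_{n²}·ζ(n²−1)) + 1 + 1/K_{n²}]. -/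
open scoped ENNReal

noncomputable section

/-- Frobenius norm of a real matrix. -/
def frobNorm {n : ℕ} (M : Matrix (Fin n) (Fin n) ℝ) : ℝ :=
  Real.sqrt (∑ i, ∑ j, (M i j) ^ 2)

/-- Euclidean norm on `ℝ^n`. -/
def eNorm {n : ℕ} (v : Fin n → ℝ) : ℝ := Real.sqrt (∑ i, (v i) ^ 2)

/-- Operator norm of a real matrix. -/
def opNorm {n : ℕ} (M : Matrix (Fin n) (Fin n) ℝ) : ℝ :=
  sSup {t : ℝ | ∃ v : Fin n → ℝ, eNorm v = 1 ∧ t = eNorm (M.mulVec v)}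

open Classical in
/-- The condition number `μ(M) = ‖M‖_F·‖M⁻¹‖`, with value `+∞` at singular matrices. -/
def muE {n : ℕ} (M : Matrix (Fin n) (Fin n) ℝ) : ℝ≥0∞ :=
  if IsUnit M.det then ENNReal.ofReal (frobNorm M * opNorm M⁻¹) else ⊤

/-- The condition number `μ` of a rational projective point (computed on a representative;
`μ` only depends on the projective class). -/
def muP {n : ℕ} (P : Projectivization ℚ (Matrix (Fin n) (Fin n) ℚ)) : ℝ≥0∞ :=
  muE ((Projectivization.rep P).map (Rat.cast : ℚ → ℝ))

/-- The point of `ℙ(M_n(ℚ))` has Northcott–Schmidt height at most `H`. -/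
def heightLE {n : ℕ} (P : Projectivization ℚ (Matrix (Fin n) (Fin n) ℚ)) (H : ℝ) : Prop :=
  ∃ (A : Matrix (Fin n) (Fin n) ℤ) (h0 : (A.map (Int.cast : ℤ → ℚ)) ≠ 0),
    (Finset.univ.gcd (fun p : Fin n × Fin n => A p.1 p.2) = 1) ∧
    P = Projectivization.mk ℚ (A.map (Int.cast : ℤ → ℚ)) h0 ∧
    frobNorm (A.map (Int.cast : ℤ → ℝ)) ≤ H

/-- `K_ℓ = π^{ℓ/2}/Γ(ℓ/2 + 1)`, the volume of the unit ball in `ℝ^ℓ`. -/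
def Kvol (ℓ : ℕ) : ℝ := Real.pi ^ ((ℓ : ℝ) / 2) / Real.Gamma ((ℓ : ℝ) / 2 + 1)

/-- `𝔖^{(m)} = Σ_{ℓ=0}^{m-1} C(m,ℓ)·K_ℓ`. -/
def Sfrak (m : ℕ) : ℝ := ∑ ℓ ∈ Finset.range m, (m.choose ℓ : ℝ) * Kvol ℓ

/-- `T_n = (2·max{4,n})^{2n⁴+4n²}`. -/
def Tconst (n : ℕ) : ℝ := ((2 * max 4 n : ℕ) : ℝ) ^ (2 * n ^ 4 + 4 * n ^ 2)

/-- `ζ(m) = Σ_{k≥1} 1/k^m`, the Riemann zeta function at a positive integer. -/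
def zetaN (m : ℕ) : ℝ := ∑' k : ℕ, 1 / ((k : ℝ) + 1) ^ m

/-- `B(ε,n)` of Statement 1. -/
def Bconst (ε : ℝ) (n : ℕ) : ℝ :=
  zetaN (n ^ 2) *
    ((Tconst n + ε * (n : ℝ) ^ ((5 : ℝ) / 2)) * Sfrak (n ^ 2) /
        (Kvol (n ^ 2) * zetaN (n ^ 2 - 1)) +
      2 * ε * (n : ℝ) ^ ((5 : ℝ) / 2) + 2 / Kvol (n ^ 2))

/-- `C(n)` of Statement 1. -/
def Cconst (n : ℕ) : ℝ :=
  zetaN (n ^ 2) *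
    (Sfrak (n ^ 2) / (Kvol (n ^ 2) * zetaN (n ^ 2 - 1)) + 1 + 1 / Kvol (n ^ 2))

open MeasureTheory

section Volume

variable {ι : Type*} [Fintype ι]

/-- Euclidean norm on functions over a finite type. -/
def l2 (x : ι → ℝ) : ℝ := Real.sqrt (∑ i, x i ^ 2)

lemma l2_eq_norm (x : ι → ℝ) : l2 x = ‖WithLp.toLp 2 x‖ := by
  simp [l2, EuclideanSpace.norm_eq]

lemma l2_nonneg (x : ι → ℝ) : 0 ≤ l2 x := Real.sqrt_nonneg _

lemma l2_sq (x : ι → ℝ) : l2 x ^ 2 = ∑ i, x i ^ 2 :=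
  Real.sq_sqrt (Finset.sum_nonneg fun _ _ => sq_nonneg _)

lemma l2_add_le (x y : ι → ℝ) : l2 (x + y) ≤ l2 x + l2 y := by
  simp only [l2_eq_norm, WithLp.toLp_add]
  exact norm_add_le _ _

lemma l2_smul (c : ℝ) (x : ι → ℝ) : l2 (c • x) = |c| * l2 x := by
  simp only [l2_eq_norm, WithLp.toLp_smul, norm_smul, Real.norm_eq_abs]

lemma l2_le_iff {x : ι → ℝ} {R : ℝ} (hR : 0 ≤ R) : l2 x ≤ R ↔ ∑ i, x i ^ 2 ≤ R ^ 2 :=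
  Real.sqrt_le_left hR

lemma abs_sum_mul_le_l2 (x y : ι → ℝ) : |∑ i, x i * y i| ≤ l2 x * l2 y := by
  apply abs_le_of_sq_le_sq _ (mul_nonneg (l2_nonneg _) (l2_nonneg _))
  rw [mul_pow, l2_sq, l2_sq]
  exact Finset.sum_mul_sq_le_sq_mul_sq _ _ _

lemma abs_le_l2 (x : ι → ℝ) (i : ι) : |x i| ≤ l2 x := by
  apply Real.abs_le_sqrt
  exact Finset.single_le_sum (f := fun i => x i ^ 2) (fun _ _ => sq_nonneg _) (Finset.mem_univ i)

lemma Kvol_pos (ℓ : ℕ) : 0 < Kvol ℓ := by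
  unfold Kvol
  have : 0 < Real.Gamma ((ℓ : ℝ) / 2 + 1) := Real.Gamma_pos_of_pos (by positivity)
  have := Real.pi_pos
  positivity

lemma volume_l2_le [Nonempty ι] {R : ℝ} (hR : 0 ≤ R) :
    volume {x : ι → ℝ | l2 x ≤ R} =
      ENNReal.ofReal (Kvol (Fintype.card ι) * R ^ Fintype.card ι) := by
  have h : {x : ι → ℝ | l2 x ≤ R} =
      (WithLp.toLp 2) ⁻¹' (Metric.closedBall (0 : EuclideanSpace ℝ ι) R) := by
    ext x
    simp [l2_eq_norm]
  rw [h, (PiLp.volume_preserving_toLp ι).measure_preimage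
    Metric.isClosed_closedBall.measurableSet.nullMeasurableSet,
    EuclideanSpace.volume_closedBall, ← ENNReal.ofReal_pow hR,
    ← ENNReal.ofReal_mul (by positivity), mul_comm]
  congr 2
  unfold Kvol
  rw [Real.sqrt_eq_rpow, ← Real.rpow_natCast, ← Real.rpow_mul Real.pi_pos.le]
  congr 2
  ring

/-- Slabs of a ball orthogonal to any two unit directions have the same volume. -/
lemma volume_slab_rotate {ν : ι → ℝ} (hν : ∑ k, ν k ^ 2 = 1) (k₀ : ι) (ρ t : ℝ) :
    volume {c : ι → ℝ | ∑ k, c k ^ 2 ≤ ρ ∧ |∑ k, ν k * c k| ≤ t} =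
      volume {c : ι → ℝ | ∑ k, c k ^ 2 ≤ ρ ∧ |c k₀| ≤ t} := by
  classical
  have hn : ‖(WithLp.toLp 2 ν : EuclideanSpace ℝ ι)‖ = 1 := by
    rw [← l2_eq_norm, l2, hν, Real.sqrt_one]
  obtain ⟨b, hb⟩ := Orthonormal.exists_orthonormalBasis_extension_of_card_eq
    (𝕜 := ℝ) (E := EuclideanSpace ℝ ι) (ι := ι) (by simp) (v := fun _ => WithLp.toLp 2 ν) (s := {k₀})
    (by
      refine ⟨fun i => hn, fun i j hij => ?_⟩
      exact absurd (Subsingleton.elim i j) hij)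
  have hb0 := hb k₀ rfl
  let S : Set (EuclideanSpace ℝ ι) := {c | ‖c‖ ^ 2 ≤ ρ ∧ |c k₀| ≤ t}
  have hS : MeasurableSet S := by
    simp only [S, Set.ofPred_and]
    exact ((isClosed_le (by fun_prop) (by fun_prop)).inter
      (isClosed_le (by fun_prop) (by fun_prop))).measurableSet
  have hmp : MeasurePreserving b.repr volume volume := b.repr.measurePreserving
  have h1 : {c : ι → ℝ | ∑ k, c k ^ 2 ≤ ρ ∧ |∑ k, ν k * c k| ≤ t} =
      (WithLp.toLp 2) ⁻¹' (b.repr ⁻¹' S) := by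
    ext c
    have e1 : (b.repr (WithLp.toLp 2 c)) k₀ = ∑ k, ν k * c k := by
      rw [b.repr_apply_apply, hb0]
      simp [PiLp.inner_apply, mul_comm]
    simp only [Set.mem_ofPred_eq, Set.mem_preimage, S, LinearIsometryEquiv.norm_map, e1,
      ← l2_eq_norm, l2_sq]
  have h2 : {c : ι → ℝ | ∑ k, c k ^ 2 ≤ ρ ∧ |c k₀| ≤ t} = (WithLp.toLp 2) ⁻¹' S := by
    ext c
    simp only [Set.mem_ofPred_eq, Set.mem_preimage, S, ← l2_eq_norm, l2_sq]
  rw [h1, h2, (PiLp.volume_preserving_toLp ι).measure_preimage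
    (hmp.measurable hS).nullMeasurableSet, hmp.measure_preimage hS.nullMeasurableSet,
    (PiLp.volume_preserving_toLp ι).measure_preimage hS.nullMeasurableSet]

lemma sum_subtype_add_sum_not (p : ι → Prop) [DecidablePred p] (f : ι → ℝ) :
    ∑ i : Subtype p, f i + ∑ i : {i // ¬p i}, f i = ∑ i, f i :=
  Fintype.sum_subtype_add_sum_subtype p f

/-- If every slice of `T` over the coordinates outside `p` lies in a slab of width `t`, then `T`
is no larger than a coordinate slab of the ball. -/
lemma volume_le_volume_coordinate_slab (p : ι → Prop) [DecidablePred p] {q₀ : ι} (hq : p q₀)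
    {T : Set (ι → ℝ)} (hT : MeasurableSet T) {ρ t : ℝ}
    (hR : ∀ x ∈ T, ∑ i, x i ^ 2 ≤ ρ)
    (h : ∀ x : ι → ℝ, ∃ ν : Subtype p → ℝ, ∑ k, ν k ^ 2 = 1 ∧
      ∀ x' ∈ T, (∀ i, ¬p i → x' i = x i) → |∑ k : Subtype p, ν k * x' k| ≤ t) :
    volume T ≤ volume {x : ι → ℝ | ∑ i, x i ^ 2 ≤ ρ ∧ |x q₀| ≤ t} := by
  let e := MeasurableEquiv.piEquivPiSubtypeProd (fun _ : ι => ℝ) p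
  have he : MeasurePreserving e volume volume :=
    volume_preserving_piEquivPiSubtypeProd (fun _ : ι => ℝ) p
  have hU : MeasurableSet {x : ι → ℝ | ∑ i, x i ^ 2 ≤ ρ ∧ |x q₀| ≤ t} := by
    simp only [Set.ofPred_and]
    exact ((isClosed_le (by fun_prop) (by fun_prop)).inter
      (isClosed_le (by fun_prop) (by fun_prop))).measurableSet
  rw [← he.symm.measure_preimage hT.nullMeasurableSet,
    ← he.symm.measure_preimage hU.nullMeasurableSet, Measure.volume_eq_prod,
    Measure.prod_apply_symm (e.symm.measurable hT),
    Measure.prod_apply_symm (e.symm.measurable hU)]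
  apply lintegral_mono
  intro y
  have hin : ∀ (c : Subtype p → ℝ) (k : Subtype p), e.symm (c, y) k = c k := by
    intro c k
    have : (e (e.symm (c, y))).1 k = c k := by rw [e.apply_symm_apply]
    exact this
  have hout : ∀ (c : Subtype p → ℝ) (k : {i // ¬p i}), e.symm (c, y) k = y k := by
    intro c k
    have : (e (e.symm (c, y))).2 k = y k := by rw [e.apply_symm_apply]
    exact this
  have hsum : ∀ c : Subtype p → ℝ, ∑ i, (e.symm (c, y) i) ^ 2 = ∑ k, c k ^ 2 + ∑ k, y k ^ 2 := by
    intro c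
    rw [← sum_subtype_add_sum_not p]
    simp only [hin, hout]
  obtain ⟨ν, hν, hν'⟩ := h (e.symm (0, y))
  have hrot := volume_slab_rotate hν ⟨q₀, hq⟩ (ρ - ∑ k, y k ^ 2) t
  calc volume ((fun c => (c, y)) ⁻¹' (e.symm ⁻¹' T))
      ≤ volume {c : Subtype p → ℝ | ∑ k, c k ^ 2 ≤ ρ - ∑ k, y k ^ 2 ∧
          |∑ k, ν k * c k| ≤ t} := by
        apply measure_mono
        intro c hc
        refine ⟨?_, ?_⟩
        · have := hR _ hc
          rw [hsum] at this
          linarith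
        · have := hν' _ hc (fun i hi => by rw [hout c ⟨i, hi⟩, hout 0 ⟨i, hi⟩])
          simpa only [hin] using this
    _ = _ := hrot
    _ ≤ _ := by
        apply measure_mono
        intro c hc
        refine ⟨?_, ?_⟩
        · rw [hsum]
          linarith [hc.1]
        · have := hin c ⟨q₀, hq⟩
          simp only at this
          rw [this]
          exact hc.2

lemma volume_coordinate_slab_le (hN : 2 ≤ Fintype.card ι) (q₀ : ι) {R t : ℝ} (hR : 0 ≤ R)
    (ht : 0 ≤ t) :
    volume {x : ι → ℝ | ∑ i, x i ^ 2 ≤ R ^ 2 ∧ |x q₀| ≤ t} ≤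
      ENNReal.ofReal (2 * t * (Kvol (Fintype.card ι - 1) * R ^ (Fintype.card ι - 1))) := by
  classical
  obtain ⟨p, hp⟩ : ∃ p : ι → Prop, ∀ i, p i ↔ i = q₀ := ⟨(· = q₀), fun _ => Iff.rfl⟩
  have hcard1 : Fintype.card (Subtype p) = 1 :=
    Fintype.card_eq_one_iff.mpr ⟨⟨q₀, (hp _).mpr rfl⟩, fun y => Subtype.ext ((hp _).mp y.2)⟩
  let e := MeasurableEquiv.piEquivPiSubtypeProd (fun _ : ι => ℝ) p
  have he : MeasurePreserving e volume volume :=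
    volume_preserving_piEquivPiSubtypeProd (fun _ : ι => ℝ) p
  have hcard : Fintype.card {i // ¬ p i} = Fintype.card ι - 1 := by
    rw [Fintype.card_subtype_compl, hcard1]
  have : Nonempty {i // ¬ p i} := by
    rw [← Fintype.card_pos_iff]
    omega
  let A : Set (Subtype p → ℝ) := Set.univ.pi fun _ => Set.Icc (-t) t
  let D : Set ({i // ¬ p i} → ℝ) := {y | l2 y ≤ R}
  have hsub : {x : ι → ℝ | ∑ i, x i ^ 2 ≤ R ^ 2 ∧ |x q₀| ≤ t} ⊆ e ⁻¹' (A ×ˢ D) := by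
    rintro x ⟨h1, h2⟩
    refine ⟨?_, ?_⟩
    · rintro ⟨i, hi⟩ -
      obtain rfl := (hp i).mp hi
      exact abs_le.mp h2
    · change l2 _ ≤ R
      rw [l2_le_iff hR]
      refine le_trans ?_ h1
      rw [← sum_subtype_add_sum_not p]
      exact le_add_of_nonneg_left (Finset.sum_nonneg fun _ _ => sq_nonneg _)
  refine (measure_mono hsub).trans ?_
  rw [he.measure_preimage_equiv, Measure.volume_eq_prod, Measure.prod_prod, volume_l2_le hR, hcard,
    volume_pi_pi]
  simp only [Real.volume_Icc, Finset.prod_const, Finset.card_univ, hcard1, pow_one]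
  rw [← ENNReal.ofReal_mul (by linarith)]
  apply le_of_eq
  congr 2
  ring

end Volume

section LatticePoints

variable {ι : Type*}

/-- The half-open unit cube centred at an integer point. -/
def unitCube (A : ι → ℤ) : Set (ι → ℝ) :=
  Set.univ.pi fun i => Set.Ico ((A i : ℝ) - 1 / 2) ((A i : ℝ) + 1 / 2)

lemma eq_of_mem_unitCube {A A' : ι → ℤ} {x : ι → ℝ} (h : x ∈ unitCube A)
    (h' : x ∈ unitCube A') : A = A' := by
  funext i
  have h1 := h i trivial
  have h2 := h' i trivial
  have h3 : (A i : ℝ) < A' i + 1 := by linarith [h1.1, h2.2]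
  have h4 : (A' i : ℝ) < A i + 1 := by linarith [h2.1, h1.2]
  norm_cast at h3 h4
  omega

lemma exists_mem_unitCube (x : ι → ℝ) : ∃ A, x ∈ unitCube A := by
  refine ⟨fun i => ⌊x i + 1 / 2⌋, fun i _ => ⟨?_, ?_⟩⟩
  · linarith [Int.floor_le (x i + 1 / 2)]
  · linarith [Int.lt_floor_add_one (x i + 1 / 2)]

variable [Fintype ι]

lemma volume_unitCube (A : ι → ℤ) : volume (unitCube A) = 1 := by
  rw [unitCube, Real.volume_pi_Ico]
  apply Finset.prod_eq_one
  intro i _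
  rw [← ENNReal.ofReal_one]
  congr 1
  ring

lemma measurableSet_unitCube (A : ι → ℤ) : MeasurableSet (unitCube A) :=
  MeasurableSet.univ_pi fun _ => measurableSet_Ico

lemma l2_sub_le_of_mem_unitCube {A : ι → ℤ} {x : ι → ℝ} (h : x ∈ unitCube A) :
    l2 (x - fun i => (A i : ℝ)) ≤ Real.sqrt (Fintype.card ι) / 2 := by
  rw [l2_le_iff (by positivity), div_pow, Real.sq_sqrt (by positivity)]
  calc ∑ i, (x - fun i => (A i : ℝ)) i ^ 2 ≤ ∑ _i : ι, (1 / 4 : ℝ) := by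
        apply Finset.sum_le_sum
        intro i _
        have h1 := h i trivial
        simp only [Pi.sub_apply]
        nlinarith [h1.1, h1.2]
    _ = _ := by
        simp
        ring

lemma card_le_volume {S : Finset (ι → ℤ)} {T : Set (ι → ℝ)} (h : ∀ A ∈ S, unitCube A ⊆ T) :
    (S.card : ℝ≥0∞) ≤ volume T := by
  calc (S.card : ℝ≥0∞) = ∑ A ∈ S, volume (unitCube A) := by simp [volume_unitCube]
    _ = volume (⋃ A ∈ S, unitCube A) := by
        rw [measure_biUnion_finset _ fun A _ => measurableSet_unitCube A]
        intro A _ A' _ hne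
        rw [Function.onFun, Set.disjoint_left]
        exact fun x h1 h2 => hne (eq_of_mem_unitCube h1 h2)
    _ ≤ volume T := measure_mono (Set.iUnion₂_subset h)

lemma volume_le_card {S : Finset (ι → ℤ)} {T : Set (ι → ℝ)} (h : T ⊆ ⋃ A ∈ S, unitCube A) :
    volume T ≤ (S.card : ℝ≥0∞) := by
  calc volume T ≤ volume (⋃ A ∈ S, unitCube A) := measure_mono h
    _ ≤ ∑ A ∈ S, volume (unitCube A) := measure_biUnion_finset_le _ _
    _ = S.card := by simp [volume_unitCube]

variable (ι) in
lemma finite_l2_le (R : ℝ) : {A : ι → ℤ | l2 (fun i => (A i : ℝ)) ≤ R}.Finite := by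
  classical
  apply (Set.finite_Icc (fun _ : ι => -⌈R⌉) (fun _ => ⌈R⌉)).subset
  intro A hA
  have h : ∀ i, |A i| ≤ ⌈R⌉ := by
    intro i
    have h1 := (abs_le_l2 (fun i => (A i : ℝ)) i).trans (hA.trans (Int.le_ceil R))
    exact_mod_cast h1
  exact ⟨fun i => (abs_le.mp (h i)).1, fun i => (abs_le.mp (h i)).2⟩

variable (ι) in
/-- The integer points of Euclidean norm at most `R`. -/
def intBall (R : ℝ) : Finset (ι → ℤ) := (finite_l2_le ι R).toFinset

lemma mem_intBall {R : ℝ} {A : ι → ℤ} : A ∈ intBall ι R ↔ l2 (fun i => (A i : ℝ)) ≤ R := by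
  simp [intBall]

lemma card_intBall_le [Nonempty ι] {R : ℝ} (hR : 0 ≤ R) :
    ((intBall ι R).card : ℝ) ≤ Kvol (Fintype.card ι) *
      (R + Real.sqrt (Fintype.card ι) / 2) ^ Fintype.card ι := by
  have hK := (Kvol_pos (Fintype.card ι)).le
  have h : ((intBall ι R).card : ℝ≥0∞) ≤
      volume {x : ι → ℝ | l2 x ≤ R + Real.sqrt (Fintype.card ι) / 2} := by
    apply card_le_volume
    intro A hA x hx
    have h1 := l2_add_le (fun i => (A i : ℝ)) (x - fun i => (A i : ℝ))
    rw [add_sub_cancel] at h1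
    exact h1.trans (add_le_add (mem_intBall.mp hA) (l2_sub_le_of_mem_unitCube hx))
  rw [volume_l2_le (by positivity), ← ENNReal.ofReal_natCast] at h
  exact (ENNReal.ofReal_le_ofReal_iff (by positivity)).mp h

lemma le_card_intBall [Nonempty ι] {R : ℝ} (hR : Real.sqrt (Fintype.card ι) / 2 ≤ R) :
    Kvol (Fintype.card ι) * (R - Real.sqrt (Fintype.card ι) / 2) ^ Fintype.card ι ≤
      ((intBall ι R).card : ℝ) := by
  have h : volume {x : ι → ℝ | l2 x ≤ R - Real.sqrt (Fintype.card ι) / 2} ≤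
      ((intBall ι R).card : ℝ≥0∞) := by
    apply volume_le_card
    intro x hx
    obtain ⟨A, hA⟩ := exists_mem_unitCube x
    have h1 := l2_add_le x ((-1 : ℝ) • (x - fun i => (A i : ℝ)))
    rw [l2_smul] at h1
    have h2 := l2_sub_le_of_mem_unitCube hA
    have h3 : l2 x ≤ R - Real.sqrt (Fintype.card ι) / 2 := hx
    have h4 : x + (-1 : ℝ) • (x - fun i => (A i : ℝ)) = fun i => (A i : ℝ) := by
      funext i
      simp
    rw [h4] at h1
    norm_num at h1
    exact Set.mem_biUnion (mem_intBall.mpr (by linarith)) hA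
  rw [volume_l2_le (by linarith), ← ENNReal.ofReal_natCast] at h
  exact (ENNReal.ofReal_le_ofReal_iff (by positivity)).mp h

open Classical in
variable (ι) in
/-- The primitive integer points of Euclidean norm at most `R`. -/
def primBall (R : ℝ) : Finset (ι → ℤ) :=
  (intBall ι R).filter fun A => Finset.univ.gcd A = 1

open Classical in
/-- A non-primitive integer point in a ball is `d` times an integer point, for some `d ≥ 2`. -/
lemma card_intBall_le_card_primBall_add {H : ℝ} (hH : 2 ≤ H) :
    (intBall ι H).card ≤ (primBall ι H).card +
      ∑ d ∈ Finset.Icc 2 ⌊H⌋₊, (intBall ι (H / d)).card := by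
  have hsub : intBall ι H ⊆ primBall ι H ∪
      (Finset.Icc 2 ⌊H⌋₊).biUnion fun d => (intBall ι (H / d)).image fun A => (d : ℤ) • A := by
    intro A hA
    have key : ∀ d : ℕ, 2 ≤ d → (d : ℝ) ≤ H → (∀ i, (d : ℤ) ∣ A i) →
        A ∈ (Finset.Icc 2 ⌊H⌋₊).biUnion
          fun d => (intBall ι (H / d)).image fun A => (d : ℤ) • A := by
      intro d hd2 hdH hdvd
      choose B hB using hdvd
      have hd : (0 : ℝ) < d := by positivity
      rw [Finset.mem_biUnion]
      refine ⟨d, Finset.mem_Icc.mpr ⟨hd2, Nat.le_floor hdH⟩, Finset.mem_image.mpr ⟨B, ?_, ?_⟩⟩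
      · rw [mem_intBall] at hA ⊢
        have : (fun i => (A i : ℝ)) = (d : ℝ) • fun i => (B i : ℝ) := by
          funext i
          simp [hB]
        rw [this, l2_smul, abs_of_pos hd] at hA
        rw [le_div_iff₀ hd]
        linarith
      · funext i
        simp [hB]
    rw [Finset.mem_union]
    by_cases hg : Finset.univ.gcd A = 1
    · exact Or.inl (Finset.mem_filter.mpr ⟨hA, hg⟩)
    · right
      by_cases h0 : ∀ i, A i = 0
      · exact key 2 le_rfl (by exact_mod_cast hH) fun i => by rw [h0 i]; exact dvd_zero _
      · push Not at h0
        obtain ⟨i, hi⟩ := h0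
        have hdvd : ∀ i, Finset.univ.gcd A ∣ A i := fun i => Finset.gcd_dvd (Finset.mem_univ i)
        have hnn : 0 ≤ Finset.univ.gcd A := by
          exact Int.nonneg_iff_normalize_eq_self _ |>.mp Finset.normalize_gcd
        obtain ⟨d, hd⟩ := Int.eq_ofNat_of_zero_le hnn
        rw [hd] at hdvd hg
        have hd0 : d ≠ 0 := by
          rintro rfl
          exact hi (by simpa using hdvd i)
        have hd1 : d ≠ 1 := by
          rintro rfl
          exact hg rfl
        apply key d (by omega) _ hdvd
        have h1 : (d : ℤ) ≤ |A i| :=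
          Int.le_of_dvd (abs_pos.mpr hi) ((dvd_abs _ _).mpr (hdvd i))
        have h2 : (d : ℝ) ≤ |(A i : ℝ)| := by exact_mod_cast h1
        exact h2.trans ((abs_le_l2 (fun i => (A i : ℝ)) i).trans (mem_intBall.mp hA))
  calc (intBall ι H).card ≤ _ := Finset.card_le_card hsub
    _ ≤ _ := Finset.card_union_le _ _
    _ ≤ _ := by
        gcongr
        exact Finset.card_biUnion_le.trans (Finset.sum_le_sum fun d _ => Finset.card_image_le)

lemma le_card_primBall [Nonempty ι] {H : ℝ} (hH : 2 ≤ H)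
    (hH' : Real.sqrt (Fintype.card ι) / 2 ≤ H) :
    Kvol (Fintype.card ι) * ((H - Real.sqrt (Fintype.card ι) / 2) ^ Fintype.card ι -
      ∑ d ∈ Finset.Icc 2 ⌊H⌋₊, (H / d + Real.sqrt (Fintype.card ι) / 2) ^ Fintype.card ι) ≤
      ((primBall ι H).card : ℝ) := by
  have h1 := le_card_intBall hH'
  have h2 : ((intBall ι H).card : ℝ) ≤ (primBall ι H).card +
      ∑ d ∈ Finset.Icc 2 ⌊H⌋₊, ((intBall ι (H / d)).card : ℝ) := by
    exact_mod_cast card_intBall_le_card_primBall_add hH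
  have h3 : ∑ d ∈ Finset.Icc 2 ⌊H⌋₊, ((intBall ι (H / d)).card : ℝ) ≤
      ∑ d ∈ Finset.Icc 2 ⌊H⌋₊, Kvol (Fintype.card ι) *
        (H / d + Real.sqrt (Fintype.card ι) / 2) ^ Fintype.card ι :=
    Finset.sum_le_sum fun d _ => card_intBall_le (by positivity)
  rw [← Finset.mul_sum] at h3
  rw [mul_sub]
  linarith

end LatticePoints

section Numerics

lemma Gamma_add_half_sq_le {x : ℝ} (hx : 0 < x) :
    Real.Gamma (x + 1 / 2) ^ 2 ≤ Real.Gamma x * Real.Gamma (x + 1) := by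
  have h := Real.Gamma_mul_add_mul_le_rpow_Gamma_mul_rpow_Gamma hx (add_pos hx one_pos)
    (a := 1 / 2) (b := 1 / 2) (by norm_num) (by norm_num) (by norm_num)
  have e : 1 / 2 * x + 1 / 2 * (x + 1) = x + 1 / 2 := by ring
  have h1 := Real.Gamma_pos_of_pos hx
  have h2 := Real.Gamma_pos_of_pos (add_pos hx one_pos)
  have h3 : 0 < Real.Gamma (x + 1 / 2) := Real.Gamma_pos_of_pos (by linarith)
  rw [e, ← Real.sqrt_eq_rpow, ← Real.sqrt_eq_rpow, ← Real.sqrt_mul h1.le] at h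
  exact (Real.le_sqrt' h3).mp h

lemma Kvol_sq (ℓ : ℕ) :
    Kvol ℓ ^ 2 * Real.Gamma ((ℓ : ℝ) / 2 + 1) ^ 2 = Real.pi ^ ℓ := by
  have : 0 < Real.Gamma ((ℓ : ℝ) / 2 + 1) := Real.Gamma_pos_of_pos (by positivity)
  unfold Kvol
  rw [div_pow, div_mul_cancel₀ _ (by positivity), ← Real.rpow_natCast, ← Real.rpow_mul
    Real.pi_pos.le, ← Real.rpow_natCast]
  congr 1
  push_cast
  ring

/-- `K_m² / K_{m+1}² ≤ (m + 2) / (2π)`. -/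
lemma Kvol_sq_le (m : ℕ) : 2 * Real.pi * Kvol m ^ 2 ≤ (m + 2) * Kvol (m + 1) ^ 2 := by
  have h1 := Kvol_sq m
  have h2 := Kvol_sq (m + 1)
  have h3 := Gamma_add_half_sq_le (x := (m : ℝ) / 2 + 1) (by positivity)
  have h4 := Real.Gamma_add_one (s := (m : ℝ) / 2 + 1) (by positivity)
  have e : ((m + 1 : ℕ) : ℝ) / 2 + 1 = (m : ℝ) / 2 + 1 + 1 / 2 := by push_cast; ring
  rw [e, pow_succ Real.pi, ← h1] at h2
  rw [h4] at h3
  have g1 : 0 < Real.Gamma ((m : ℝ) / 2 + 1) := Real.Gamma_pos_of_pos (by positivity)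
  set g := Real.Gamma ((m : ℝ) / 2 + 1)
  set g' := Real.Gamma ((m : ℝ) / 2 + 1 + 1 / 2)
  have h5 : Kvol (m + 1) ^ 2 * g' ^ 2 ≤ Kvol (m + 1) ^ 2 * (g * (((m : ℝ) / 2 + 1) * g)) := by
    gcongr
  rw [h2] at h5
  have : g ^ 2 * (2 * Real.pi * Kvol m ^ 2) ≤ g ^ 2 * ((m + 2) * Kvol (m + 1) ^ 2) := by
    nlinarith
  exact le_of_mul_le_mul_left this (by positivity)

/-- `K_m² / K_{m+1}² ≥ (m + 1) / (2π)`. -/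
lemma le_Kvol_sq (m : ℕ) : (m + 1) * Kvol (m + 1) ^ 2 ≤ 2 * Real.pi * Kvol m ^ 2 := by
  have h1 := Kvol_sq m
  have h2 := Kvol_sq (m + 1)
  have h3 := Gamma_add_half_sq_le (x := (m : ℝ) / 2 + 1 / 2) (by positivity)
  have h4 := Real.Gamma_add_one (s := (m : ℝ) / 2 + 1 / 2) (by positivity)
  have e : ((m + 1 : ℕ) : ℝ) / 2 + 1 = (m : ℝ) / 2 + 1 / 2 + 1 := by push_cast; ring
  have e' : (m : ℝ) / 2 + 1 / 2 + 1 / 2 = (m : ℝ) / 2 + 1 := by ring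
  rw [e, pow_succ Real.pi, ← h1] at h2
  rw [e'] at h3
  have g1 : 0 < Real.Gamma ((m : ℝ) / 2 + 1) := Real.Gamma_pos_of_pos (by positivity)
  set g := Real.Gamma ((m : ℝ) / 2 + 1)
  set g' := Real.Gamma ((m : ℝ) / 2 + 1 / 2 + 1)
  have h6 : ((m : ℝ) / 2 + 1 / 2) * g ^ 2 ≤ g' ^ 2 := by
    calc ((m : ℝ) / 2 + 1 / 2) * g ^ 2 ≤
        ((m : ℝ) / 2 + 1 / 2) * (Real.Gamma ((m : ℝ) / 2 + 1 / 2) * g') := by gcongr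
      _ = g' ^ 2 := by rw [← mul_assoc, ← h4, sq]
  have h5 : Kvol (m + 1) ^ 2 * (((m : ℝ) / 2 + 1 / 2) * g ^ 2) ≤ Kvol (m + 1) ^ 2 * g' ^ 2 := by
    gcongr
  rw [h2] at h5
  have : g ^ 2 * ((m + 1) * Kvol (m + 1) ^ 2) ≤ g ^ 2 * (2 * Real.pi * Kvol m ^ 2) := by
    nlinarith
  exact le_of_mul_le_mul_left this (by positivity)

lemma summable_zetaN {m : ℕ} (hm : 2 ≤ m) : Summable fun k : ℕ => 1 / ((k : ℝ) + 1) ^ m := by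
  have h := (summable_nat_add_iff 1).mpr (Real.summable_one_div_nat_pow.mpr hm)
  simpa using h

lemma one_le_zetaN {m : ℕ} (hm : 2 ≤ m) : 1 ≤ zetaN m := by
  have h := (summable_zetaN hm).le_tsum 0 (fun k _ => by positivity)
  simpa [zetaN] using h

lemma zetaN_le_two {m : ℕ} (hm : 2 ≤ m) : zetaN m ≤ 2 := by
  have h1 : zetaN m ≤ zetaN 2 := by
    apply (summable_zetaN hm).tsum_le_tsum _ (summable_zetaN le_rfl)
    intro k
    apply one_div_le_one_div_of_le (by positivity)
    exact pow_le_pow_right₀ (by linarith [(Nat.cast_nonneg k : (0 : ℝ) ≤ k)]) hm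
  have h2 : zetaN 2 = Real.pi ^ 2 / 6 := by
    have h := hasSum_zeta_two
    rw [← hasSum_nat_add_iff' 1] at h
    simp only [Finset.range_one, Finset.sum_singleton, Nat.cast_add, Nat.cast_one] at h
    norm_num at h
    have := h.tsum_eq
    simp only [zetaN, one_div]
    rw [← this]
  have := Real.pi_lt_d2
  have := Real.pi_pos
  nlinarith

lemma sum_one_div_pow_le {N : ℕ} (hN : 4 ≤ N) (m : ℕ) :
    ∑ d ∈ Finset.Icc 2 m, (1 / (d : ℝ)) ^ N ≤ 0.0825 := by
  have h1 : ∑ d ∈ Finset.Icc 2 m, (1 / (d : ℝ)) ^ N ≤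
      ∑ d ∈ Finset.Icc 2 m, 1 / (d : ℝ) ^ 4 := by
    apply Finset.sum_le_sum
    intro d hd
    have hd : (1 : ℝ) ≤ d := by
      have := (Finset.mem_Icc.mp hd).1
      exact_mod_cast (by omega : 1 ≤ d)
    rw [div_pow, one_pow]
    exact one_div_le_one_div_of_le (by positivity) (pow_le_pow_right₀ hd hN)
  have h2 : ∑ d ∈ insert 1 (Finset.Icc 2 m), 1 / (d : ℝ) ^ 4 ≤ Real.pi ^ 4 / 90 :=
    sum_le_hasSum _ (fun _ _ => by positivity) hasSum_zeta_four
  rw [Finset.sum_insert (by simp)] at h2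
  have h3 : Real.pi ^ 4 ≤ 3.1416 ^ 4 := by
    gcongr
    exact Real.pi_lt_d4.le
  norm_num at h2 h3 ⊢
  norm_num at h1
  linarith

lemma add_pow_le_convex {a b l : ℝ} (ha : 0 ≤ a) (hb : 0 ≤ b) (hl : 0 < l) (hl' : l < 1) (m : ℕ) :
    (a + b) ^ (m + 1) ≤ a ^ (m + 1) / (1 - l) ^ m + b ^ (m + 1) / l ^ m := by
  have hl1 : 0 < 1 - l := by linarith
  have h := (convexOn_pow (𝕜 := ℝ) (m + 1)).2 (x := a / (1 - l)) (y := b / l)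
    (Set.mem_Ici.mpr (by positivity)) (Set.mem_Ici.mpr (by positivity)) hl1.le hl.le (by ring)
  simp only [smul_eq_mul] at h
  rw [mul_div_cancel₀ _ hl1.ne', mul_div_cancel₀ _ hl.ne'] at h
  refine h.trans (le_of_eq ?_)
  rw [div_pow, div_pow, pow_succ (1 - l), pow_succ l]
  field_simp

/-- The main-term inequality behind the lower bound on the number of primitive points. -/
lemma primitive_main_term {n : ℕ} (hn : 2 ≤ n) {H : ℝ} (hH : 500000 * (n : ℝ) ^ 4 ≤ H) :
    0.9 * H ^ (n ^ 2) ≤ (H - n / 2) ^ (n ^ 2) -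
      ∑ d ∈ Finset.Icc 2 ⌊H⌋₊, (H / d + n / 2) ^ (n ^ 2) := by
  have hn' : (2 : ℝ) ≤ n := by exact_mod_cast hn
  have hN4 : 4 ≤ n ^ 2 := by nlinarith
  have hn3 : (0 : ℝ) < (n : ℝ) ^ 3 := by positivity
  have hHpos : 0 < H := lt_of_lt_of_le (by positivity) hH
  have hH3 : 1000000 * (n : ℝ) ^ 3 ≤ H := by nlinarith
  obtain ⟨m, hm⟩ : ∃ m, n ^ 2 = m + 1 := ⟨n ^ 2 - 1, by omega⟩
  have hm' : (m : ℝ) + 1 = (n : ℝ) ^ 2 := by exact_mod_cast hm.symm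
  have hm1 : m ≠ 0 := by omega
  -- the ball
  have hA : 0.999 * H ^ (n ^ 2) ≤ (H - n / 2) ^ (n ^ 2) := by
    have hx : (n : ℝ) ^ 3 / H ≤ 1 / 1000000 := by
      rw [div_le_div_iff₀ hHpos (by norm_num)]
      linarith
    have hx2 : (n : ℝ) / (2 * H) ≤ 1 := by
      rw [div_le_one (by positivity)]
      nlinarith
    have h := one_add_mul_le_pow (a := -((n : ℝ) / (2 * H))) (by linarith) (n ^ 2)
    have e : (H - n / 2) = (1 + -((n : ℝ) / (2 * H))) * H := by
      field_simp
      ring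
    rw [e, mul_pow]
    have e2 : 1 + ((n ^ 2 : ℕ) : ℝ) * -((n : ℝ) / (2 * H)) = 1 - (n : ℝ) ^ 3 / H / 2 := by
      push_cast
      field_simp
      ring
    rw [e2] at h
    gcongr
    linarith
  -- the multiples of `d`
  have hl : (0 : ℝ) < 1 / (1000 * n ^ 2) := by positivity
  have hl' : 1 / (1000 * (n : ℝ) ^ 2) ≤ 1 / 1000 := by
    apply one_div_le_one_div_of_le (by norm_num)
    nlinarith
  set l : ℝ := 1 / (1000 * (n : ℝ) ^ 2) with hldef
  have hpow : 0.999 ≤ (1 - l) ^ m := by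
    have h := one_add_mul_le_pow (a := -l) (by linarith) m
    have e : l * (n : ℝ) ^ 2 = 1 / 1000 := by
      rw [hldef]
      field_simp
    rw [← sub_eq_add_neg] at h
    nlinarith
  have hB : ∀ d ∈ Finset.Icc 2 ⌊H⌋₊, (H / d + n / 2) ^ (n ^ 2) ≤
      H ^ (n ^ 2) / 0.999 * (1 / (d : ℝ)) ^ (n ^ 2) + ((n : ℝ) / 2) ^ (m + 1) / l ^ m := by
    intro d _
    rw [hm]
    refine (add_pow_le_convex (by positivity) (by positivity) hl (by linarith) m).trans ?_
    gcongr ?_ + _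
    calc (H / d) ^ (m + 1) / (1 - l) ^ m ≤ (H / d) ^ (m + 1) / 0.999 := by gcongr
      _ = _ := by rw [div_eq_mul_one_div H, mul_pow]; ring
  have hC := Finset.sum_le_sum hB
  rw [Finset.sum_add_distrib, ← Finset.mul_sum, Finset.sum_const, nsmul_eq_mul] at hC
  have hD : H ^ (n ^ 2) / 0.999 * ∑ d ∈ Finset.Icc 2 ⌊H⌋₊, (1 / (d : ℝ)) ^ (n ^ 2) ≤
      H ^ (n ^ 2) / 0.999 * 0.0825 := by
    gcongr
    exact sum_one_div_pow_le hN4 _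
  have hcard : ((Finset.Icc 2 ⌊H⌋₊).card : ℝ) ≤ H := by
    refine le_trans ?_ (Nat.floor_le hHpos.le)
    rw [Nat.card_Icc]
    exact_mod_cast (by omega)
  have hE : ((Finset.Icc 2 ⌊H⌋₊).card : ℝ) * (((n : ℝ) / 2) ^ (m + 1) / l ^ m) ≤
      0.001 * H ^ (n ^ 2) := by
    calc ((Finset.Icc 2 ⌊H⌋₊).card : ℝ) * (((n : ℝ) / 2) ^ (m + 1) / l ^ m)
        ≤ H * (((n : ℝ) / 2) ^ (m + 1) / l ^ m) := by gcongr
      _ = H * ((n : ℝ) / 2) * (500 * (n : ℝ) ^ 3) ^ m := by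
          rw [pow_succ, mul_div_right_comm, ← div_pow]
          have : (n : ℝ) / 2 / l = 500 * (n : ℝ) ^ 3 := by
            rw [hldef]
            field_simp
            ring
          rw [this]
          ring
      _ ≤ H * ((n : ℝ) / 2) * (1 / (1000 * n) * H) ^ m := by
          have : 500 * (n : ℝ) ^ 3 ≤ 1 / (1000 * n) * H := by
            rw [one_div, inv_mul_eq_div, le_div_iff₀ (by positivity)]
            nlinarith
          gcongr
      _ = H * ((n : ℝ) / 2) * ((1 / (1000 * n)) ^ m * H ^ m) := by rw [mul_pow]
      _ ≤ H * ((n : ℝ) / 2) * ((1 / (1000 * n)) * H ^ m) := by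
          gcongr
          apply pow_le_of_le_one (by positivity) _ hm1
          rw [div_le_one (by positivity)]
          linarith
      _ = 0.0005 * H ^ (m + 1) := by
          field_simp
          ring
      _ ≤ _ := by
          rw [hm]
          gcongr
          norm_num
  have hP : 0 < H ^ (n ^ 2) := by positivity
  have hD' : H ^ (n ^ 2) / 0.999 * 0.0825 ≤ 0.083 * H ^ (n ^ 2) := by
    rw [div_mul_eq_mul_div, div_le_iff₀ (by norm_num)]
    nlinarith
  linarith

lemma Tconst_ge {n : ℕ} (hn : 2 ≤ n) : 500000 * (n : ℝ) ^ 4 ≤ Tconst n := by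
  have h : 500000 * n ^ 4 ≤ (2 * max 4 n) ^ (2 * n ^ 4 + 4 * n ^ 2) := by
    have hn4 : 2 ^ 4 ≤ n ^ 4 := Nat.pow_le_pow_left hn 4
    calc 500000 * n ^ 4 ≤ 8 ^ 10 * (2 * max 4 n) ^ 4 := by
          gcongr
          · norm_num
          · omega
      _ ≤ (2 * max 4 n) ^ 10 * (2 * max 4 n) ^ 4 := by
          gcongr
          omega
      _ = (2 * max 4 n) ^ 14 := by rw [← pow_add]
      _ ≤ _ := by
          apply Nat.pow_le_pow_right (by omega)
          omega
  unfold Tconst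
  exact_mod_cast h

end Numerics

section NearSingular

variable {n : ℕ}

/-- The matrix–vector product, for a matrix given as a function on pairs of indices. -/
def pairMulVec (x : Fin n × Fin n → ℝ) (v : Fin n → ℝ) : Fin n → ℝ :=
  fun a => ∑ j, x (a, j) * v j

lemma l2_pairMulVec_le (x : Fin n × Fin n → ℝ) (v : Fin n → ℝ) :
    l2 (pairMulVec x v) ≤ l2 x * l2 v := by
  rw [l2_le_iff (mul_nonneg (l2_nonneg _) (l2_nonneg _)), mul_pow, l2_sq, l2_sq,
    Fintype.sum_prod_type, Finset.sum_mul]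
  exact Finset.sum_le_sum fun a _ => Finset.sum_mul_sq_le_sq_mul_sq _ _ _

lemma pairMulVec_add (x y : Fin n × Fin n → ℝ) (v : Fin n → ℝ) :
    pairMulVec (x + y) v = pairMulVec x v + pairMulVec y v := by
  funext a
  simp [pairMulVec, add_mul, Finset.sum_add_distrib]

/-- Matrices of Frobenius norm at most `R` which map some unit vector with large `i`-th coordinate
to a vector of norm at most `s`. -/
def nearSingular (n : ℕ) (R s : ℝ) (i : Fin n) : Set (Fin n × Fin n → ℝ) :=
  {x | ∑ q, x q ^ 2 ≤ R ^ 2 ∧ ∃ v : Fin n → ℝ, ∑ j, v j ^ 2 = 1 ∧ 1 ≤ n * v i ^ 2 ∧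
    ∑ a, pairMulVec x v a ^ 2 ≤ s ^ 2}

lemma measurableSet_nearSingular (R s : ℝ) (i : Fin n) :
    MeasurableSet (nearSingular n R s i) := by
  let K : Set ((Fin n × Fin n → ℝ) × (Fin n → ℝ)) :=
    {z | ∑ q, z.1 q ^ 2 ≤ R ^ 2} ∩ ({z | ∑ j, z.2 j ^ 2 = 1} ∩ ({z | 1 ≤ n * z.2 i ^ 2} ∩
      {z | ∑ a, pairMulVec z.1 z.2 a ^ 2 ≤ s ^ 2}))
  have hclosed : IsClosed K := by
    refine (isClosed_le (by fun_prop) (by fun_prop)).inter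
      ((isClosed_eq (by fun_prop) (by fun_prop)).inter
        ((isClosed_le (by fun_prop) (by fun_prop)).inter
          (isClosed_le ?_ (by fun_prop))))
    unfold pairMulVec
    fun_prop
  have hcompact : IsCompact K := by
    apply IsCompact.of_isClosed_subset
      ((isCompact_Icc (a := fun _ : Fin n × Fin n => -|R|) (b := fun _ => |R|)).prod
        (isCompact_Icc (a := fun _ : Fin n => (-1 : ℝ)) (b := fun _ => 1))) hclosed
    rintro ⟨x, v⟩ ⟨h1, h2, -⟩
    have hx : ∀ q, |x q| ≤ |R| := fun q => by
      apply (abs_le_l2 x q).trans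
      rw [l2_le_iff (abs_nonneg R), sq_abs]
      exact h1
    have hv : ∀ j, |v j| ≤ 1 := fun j => by
      apply (abs_le_l2 v j).trans
      rw [l2_le_iff zero_le_one, one_pow]
      exact le_of_eq h2
    exact ⟨⟨fun q => (abs_le.mp (hx q)).1, fun q => (abs_le.mp (hx q)).2⟩,
      ⟨fun j => (abs_le.mp (hv j)).1, fun j => (abs_le.mp (hv j)).2⟩⟩
  have himg : nearSingular n R s i = Prod.fst '' K := by
    ext x
    constructor
    · rintro ⟨h1, v, h2, h3, h4⟩
      exact ⟨(x, v), ⟨h1, h2, h3, h4⟩, rfl⟩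
    · rintro ⟨⟨x, v⟩, ⟨h1, h2, h3, h4⟩, rfl⟩
      exact ⟨h1, v, h2, h3, h4⟩
  rw [himg]
  exact (hcompact.image continuous_fst).isClosed.measurableSet

/-- There is a unit vector orthogonal to all columns of a square matrix but one. -/
lemma exists_unit_orthogonal_columns (x : Fin n × Fin n → ℝ) (i : Fin n) :
    ∃ ν : Fin n → ℝ, l2 ν = 1 ∧ ∀ j, j ≠ i → ∑ a, ν a * x (a, j) = 0 := by
  let M : Matrix (Fin n) (Fin n) ℝ := fun a j => if j = i then 0 else x (a, j)
  have hdet : M.det = 0 := Matrix.det_eq_zero_of_column_eq_zero i fun a => by simp [M]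
  obtain ⟨w, hw, hwM⟩ := Matrix.exists_vecMul_eq_zero_iff.mpr hdet
  have hpos : 0 < l2 w := by
    rw [l2_eq_norm, norm_pos_iff]
    simpa using hw
  refine ⟨(l2 w)⁻¹ • w, ?_, fun j hj => ?_⟩
  · rw [l2_smul, abs_of_pos (inv_pos.mpr hpos), inv_mul_cancel₀ hpos.ne']
  · have h := congrFun hwM j
    simp only [Matrix.vecMul, dotProduct, M, if_neg hj, Pi.zero_apply] at h
    simp only [Pi.smul_apply, smul_eq_mul, mul_assoc, ← Finset.mul_sum, h, mul_zero]

lemma volume_nearSingular_le (hn : 2 ≤ n) {R s : ℝ} (hR : 0 ≤ R) (hs : 0 ≤ s) (i : Fin n) :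
    volume (nearSingular n R s i) ≤ ENNReal.ofReal
      (2 * (Real.sqrt n * s) * (Kvol (n ^ 2 - 1) * R ^ (n ^ 2 - 1))) := by
  have hcard : Fintype.card (Fin n × Fin n) = n ^ 2 := by simp [sq]
  have h1 := volume_coordinate_slab_le (ι := Fin n × Fin n) (by rw [hcard]; nlinarith) (i, i) hR
    (t := Real.sqrt n * s) (by positivity)
  rw [hcard] at h1
  refine le_trans ?_ h1
  apply volume_le_volume_coordinate_slab (fun q : Fin n × Fin n => q.2 = i) rfl
    (measurableSet_nearSingular R s i) (fun x hx => hx.1)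
  intro x
  obtain ⟨ν, hν, hort⟩ := exists_unit_orthogonal_columns x i
  let e : Fin n ≃ {q : Fin n × Fin n // q.2 = i} :=
    { toFun := fun a => ⟨(a, i), rfl⟩
      invFun := fun q => q.1.1
      left_inv := fun a => rfl
      right_inv := by
        rintro ⟨⟨a, j⟩, rfl⟩
        rfl }
  refine ⟨fun q => ν q.1.1, ?_, ?_⟩
  · rw [← e.sum_comp]
    have := l2_sq ν
    rw [hν, one_pow] at this
    exact this.symm
  · rintro x' ⟨-, v, hv1, hvi, hs'⟩ hx'
    rw [← e.sum_comp]
    change |∑ a, ν a * x' (a, i)| ≤ _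
    have hprod : ∑ a, ν a * pairMulVec x' v a = v i * ∑ a, ν a * x' (a, i) := by
      simp only [pairMulVec, Finset.mul_sum]
      rw [Finset.sum_comm, Finset.sum_eq_single i]
      · exact Finset.sum_congr rfl fun a _ => by ring
      · intro j _ hj
        have : ∀ a, x' (a, j) = x (a, j) := fun a => hx' (a, j) hj
        simp only [this]
        calc ∑ a, ν a * (x (a, j) * v j) = (∑ a, ν a * x (a, j)) * v j := by
              rw [Finset.sum_mul]
              exact Finset.sum_congr rfl fun a _ => by ring
          _ = 0 := by rw [hort j hj, zero_mul]
      · intro h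
        exact absurd (Finset.mem_univ i) h
    have hle : |v i * ∑ a, ν a * x' (a, i)| ≤ s := by
      rw [← hprod]
      refine (abs_sum_mul_le_l2 _ _).trans ?_
      rw [hν, one_mul, l2_le_iff hs]
      exact hs'
    rw [abs_mul] at hle
    have hvs : 1 ≤ Real.sqrt n * |v i| := by
      rw [← Real.sqrt_sq_eq_abs, ← Real.sqrt_mul (by positivity), Real.one_le_sqrt]
      exact hvi
    calc |∑ a, ν a * x' (a, i)| = 1 * |∑ a, ν a * x' (a, i)| := by rw [one_mul]
      _ ≤ Real.sqrt n * |v i| * |∑ a, ν a * x' (a, i)| := by gcongr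
      _ = Real.sqrt n * (|v i| * |∑ a, ν a * x' (a, i)|) := by ring
      _ ≤ Real.sqrt n * s := by gcongr

/-- A unit vector has a coordinate of absolute value at least `1 / √n`. -/
lemma exists_large_coordinate {v : Fin n → ℝ} (hv : ∑ j, v j ^ 2 = 1) :
    ∃ i, 1 ≤ n * v i ^ 2 := by
  by_contra! h
  have hne : (Finset.univ : Finset (Fin n)).Nonempty := by
    rw [Finset.nonempty_iff_ne_empty]
    intro h0
    rw [h0] at hv
    simp at hv
  have h1 := Finset.sum_lt_sum_of_nonempty hne fun i _ => h i
  rw [← Finset.mul_sum, hv] at h1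
  simp at h1

/-- The number of integer matrices in a ball which nearly annihilate a unit vector. -/
lemma card_nearSingular_le (hn : 2 ≤ n) {H s : ℝ} (hH : 0 ≤ H) (hs : 0 ≤ s)
    {S : Finset (Fin n × Fin n → ℤ)}
    (hS : ∀ A ∈ S, l2 (fun q => (A q : ℝ)) ≤ H ∧
      ∃ v : Fin n → ℝ, l2 v = 1 ∧ l2 (pairMulVec (fun q => (A q : ℝ)) v) ≤ s) :
    (S.card : ℝ) ≤ n * (2 * (Real.sqrt n * (s + n / 2)) *
      (Kvol (n ^ 2 - 1) * (H + n / 2) ^ (n ^ 2 - 1))) := by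
  have hcard : Fintype.card (Fin n × Fin n) = n ^ 2 := by simp [sq]
  have hK := (Kvol_pos (n ^ 2 - 1)).le
  have h : (S.card : ℝ≥0∞) ≤ volume (⋃ i, nearSingular n (H + n / 2) (s + n / 2) i) := by
    apply card_le_volume
    intro A hA x hx
    obtain ⟨hAH, v, hv, hAv⟩ := hS A hA
    have hd := l2_sub_le_of_mem_unitCube hx
    rw [hcard, Nat.cast_pow, Real.sqrt_sq (by positivity)] at hd
    have hv' : ∑ j, v j ^ 2 = 1 := by rw [← l2_sq, hv, one_pow]
    obtain ⟨i, hi⟩ := exists_large_coordinate hv'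
    have hx' : x = (fun q => (A q : ℝ)) + (x - fun q => (A q : ℝ)) := by rw [add_sub_cancel]
    refine Set.mem_iUnion.mpr ⟨i, ?_, v, hv', hi, ?_⟩
    · rw [← l2_le_iff (by positivity), hx']
      exact (l2_add_le _ _).trans (add_le_add hAH hd)
    · rw [← l2_le_iff (by positivity), hx', pairMulVec_add]
      refine (l2_add_le _ _).trans (add_le_add hAv ((l2_pairMulVec_le _ _).trans ?_))
      rw [hv, mul_one]
      exact hd
  have h2 := (h.trans (measure_iUnion_fintype_le _ _)).trans
    (Finset.sum_le_sum fun i _ => volume_nearSingular_le hn (by positivity) (by positivity) i)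
  rw [Finset.sum_const, Finset.card_univ, Fintype.card_fin, nsmul_eq_mul,
    ← ENNReal.ofReal_natCast, ← ENNReal.ofReal_natCast,
    ← ENNReal.ofReal_mul (by positivity)] at h2
  exact (ENNReal.ofReal_le_ofReal_iff (by positivity)).mp h2

end NearSingular

section Projective

variable {n : ℕ}

lemma frobNorm_eq_l2 (M : Matrix (Fin n) (Fin n) ℝ) :
    frobNorm M = l2 fun q : Fin n × Fin n => M q.1 q.2 := by
  rw [frobNorm, l2, Fintype.sum_prod_type]

/-- A matrix of large condition number nearly annihilates some unit vector. -/
lemma exists_small_image_of_le_muE (hn : 2 ≤ n) {M : Matrix (Fin n) (Fin n) ℝ} {ε ε' : ℝ}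
    (hε : 0 < ε) (hεε' : ε < ε') (h : ENNReal.ofReal (1 / ε) ≤ muE M) :
    ∃ v : Fin n → ℝ, l2 v = 1 ∧ l2 (M.mulVec v) ≤ ε' * frobNorm M := by
  have hfn : 0 ≤ frobNorm M := Real.sqrt_nonneg _
  have of_vector : ∀ w : Fin n → ℝ, w ≠ 0 → l2 (M.mulVec w) ≤ ε' * frobNorm M * l2 w →
      ∃ v : Fin n → ℝ, l2 v = 1 ∧ l2 (M.mulVec v) ≤ ε' * frobNorm M := by
    intro w hw hle
    have hpos : 0 < l2 w := by
      rw [l2_eq_norm, norm_pos_iff]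
      simpa using hw
    refine ⟨(l2 w)⁻¹ • w, ?_, ?_⟩
    · rw [l2_smul, abs_of_pos (inv_pos.mpr hpos), inv_mul_cancel₀ hpos.ne']
    · rw [Matrix.mulVec_smul, l2_smul, abs_of_pos (inv_pos.mpr hpos), inv_mul_eq_div,
        div_le_iff₀ hpos]
      exact hle
  unfold muE at h
  split_ifs at h with hdet
  · have hprod : 1 / ε ≤ frobNorm M * opNorm M⁻¹ := by
      by_contra! hlt
      exact absurd h (not_le.mpr ((ENNReal.ofReal_lt_ofReal_iff (by positivity)).mpr hlt))
    have hε1 : 0 < 1 / ε := by positivity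
    have hfpos : 0 < frobNorm M := by
      rcases hfn.eq_or_lt with h0 | h0
      · rw [← h0, zero_mul] at hprod
        linarith
      · exact h0
    have hε' : 0 < ε' := hε.trans hεε'
    have hlt : 1 / (ε' * frobNorm M) < opNorm M⁻¹ := by
      rw [div_lt_iff₀ (by positivity)]
      rw [div_le_iff₀ hε] at hprod
      nlinarith
    have hne : {t : ℝ | ∃ v : Fin n → ℝ, eNorm v = 1 ∧ t = eNorm (M⁻¹.mulVec v)}.Nonempty := by
      refine ⟨_, Pi.single ⟨0, by omega⟩ 1, ?_, rfl⟩
      rw [eNorm, Finset.sum_eq_single ⟨0, by omega⟩]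
      · simp
      · intro b _ hb
        simp [hb]
      · simp
    obtain ⟨_, ⟨v, hv, rfl⟩, hvlt⟩ := exists_lt_of_lt_csSup hne hlt
    have hMw : M.mulVec (M⁻¹.mulVec v) = v := by
      rw [Matrix.mulVec_mulVec, Matrix.mul_nonsing_inv _ hdet, Matrix.one_mulVec]
    have hvl : l2 v = 1 := hv
    apply of_vector (M⁻¹.mulVec v)
    · intro h0
      rw [h0, Matrix.mulVec_zero] at hMw
      rw [← hMw] at hvl
      simp [l2] at hvl
    · rw [hMw, hvl]
      rw [div_lt_iff₀ (by positivity)] at hvlt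
      have : eNorm (M⁻¹.mulVec v) = l2 (M⁻¹.mulVec v) := rfl
      rw [this] at hvlt
      linarith
  · have hdet0 : M.det = 0 := by
      by_contra h0
      exact hdet (isUnit_iff_ne_zero.mpr h0)
    obtain ⟨w, hw, hMw⟩ := Matrix.exists_mulVec_eq_zero_iff.mpr hdet0
    apply of_vector w hw
    rw [hMw]
    have : l2 (0 : Fin n → ℝ) = 0 := by simp [l2]
    rw [this]
    exact mul_nonneg (mul_nonneg (hε.trans hεε').le hfn) (l2_nonneg _)

/-- The rational matrix with given integer entries. -/
def ratMatrix (A : Fin n × Fin n → ℤ) : Matrix (Fin n) (Fin n) ℚ := fun i j => (A (i, j) : ℚ)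

lemma heightLE_iff {P : Projectivization ℚ (Matrix (Fin n) (Fin n) ℚ)} {H : ℝ} :
    heightLE P H ↔ ∃ A ∈ primBall (Fin n × Fin n) H, ∃ h0 : ratMatrix A ≠ 0,
      P = Projectivization.mk ℚ (ratMatrix A) h0 := by
  constructor
  · rintro ⟨A, h0, hg, hP, hH⟩
    refine ⟨fun q => A q.1 q.2, Finset.mem_filter.mpr ⟨mem_intBall.mpr ?_, hg⟩, h0, hP⟩
    rwa [frobNorm_eq_l2] at hH
  · rintro ⟨A, hA, h0, hP⟩
    obtain ⟨hA, hg⟩ := Finset.mem_filter.mp hA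
    refine ⟨fun i j => A (i, j), h0, hg, hP, ?_⟩
    rw [frobNorm_eq_l2]
    exact mem_intBall.mp hA

lemma ne_zero_of_gcd_eq_one {A : Fin n × Fin n → ℤ} (hA : Finset.univ.gcd A = 1) : A ≠ 0 := by
  rintro rfl
  have : Finset.univ.gcd (0 : Fin n × Fin n → ℤ) = 0 := Finset.gcd_eq_zero_iff.mpr (by simp)
  omega

lemma ratMatrix_ne_zero {A : Fin n × Fin n → ℤ} (hA : A ≠ 0) : ratMatrix A ≠ 0 := by
  intro h
  apply hA
  funext q
  have := congrFun (congrFun h q.1) q.2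
  simpa [ratMatrix] using this

/-- Primitive representatives of a rational projective point are unique up to sign. -/
lemma eq_or_eq_neg_of_mk_eq {A B : Fin n × Fin n → ℤ} (hA : Finset.univ.gcd A = 1)
    (hB : Finset.univ.gcd B = 1) (hA0 : ratMatrix A ≠ 0) (hB0 : ratMatrix B ≠ 0)
    (h : Projectivization.mk ℚ (ratMatrix A) hA0 = Projectivization.mk ℚ (ratMatrix B) hB0) :
    A = B ∨ A = -B := by
  obtain ⟨a, ha⟩ := (Projectivization.mk_eq_mk_iff' ℚ _ _ _ _).mp h
  have hmul : ∀ q, (a.den : ℤ) * A q = a.num * B q := by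
    intro q
    have h1 : a * (B q : ℚ) = A q := congrFun (congrFun ha q.1) q.2
    have h2 : (a.den : ℚ) * a = a.num := Rat.den_mul_eq_num a
    have h3 : (a.den : ℚ) * A q = a.num * B q := by rw [← h1, ← h2, mul_assoc]
    exact_mod_cast h3
  have hgcd : normalize (a.den : ℤ) = normalize a.num := by
    have h1 := Finset.gcd_mul_left (s := Finset.univ) (f := A) (a := (a.den : ℤ))
    have h2 := Finset.gcd_mul_left (s := Finset.univ) (f := B) (a := a.num)
    rw [hA, mul_one] at h1
    rw [hB, mul_one] at h2
    rw [← h1, ← h2]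
    simp only [hmul]
  have hden : (a.den : ℤ) ≠ 0 := by exact_mod_cast a.den_ne_zero
  rw [Int.normalize_coe_nat, ← Int.abs_eq_normalize] at hgcd
  rcases abs_choice a.num with habs | habs
  · left
    funext q
    have := hmul q
    rw [hgcd, habs] at this
    rw [hgcd, habs] at hden
    exact mul_left_cancel₀ hden this
  · right
    funext q
    have := hmul q
    rw [hgcd, habs] at this
    rw [hgcd, habs] at hden
    apply mul_left_cancel₀ hden
    rw [this]
    simp

variable (n) in
/-- A choice of primitive integer representatives. -/
lemma exists_primitive_representative (H : ℝ) :
    ∃ g : Projectivization ℚ (Matrix (Fin n) (Fin n) ℚ) → Fin n × Fin n → ℤ,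
      ∀ P, heightLE P H → g P ∈ primBall (Fin n × Fin n) H ∧
        ∃ h0 : ratMatrix (g P) ≠ 0, P = Projectivization.mk ℚ (ratMatrix (g P)) h0 := by
  classical
  refine ⟨fun P => if h : heightLE P H then (heightLE_iff.mp h).choose else 0, fun P hP => ?_⟩
  simp only [dif_pos hP]
  exact (heightLE_iff.mp hP).choose_spec

variable (n) in
lemma finite_heightLE (H : ℝ) :
    {P : Projectivization ℚ (Matrix (Fin n) (Fin n) ℚ) | heightLE P H}.Finite := by
  obtain ⟨g, hg⟩ := exists_primitive_representative n H
  apply Set.Finite.of_injOn (f := g) (t := ↑(primBall (Fin n × Fin n) H))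
    (fun P hP => (hg P hP).1) _ (Finset.finite_toSet _)
  intro P hP Q hQ hPQ
  obtain ⟨-, h1, e1⟩ := hg P hP
  obtain ⟨-, h2, e2⟩ := hg Q hQ
  rw [e1, e2]
  congr 1
  exact congrArg ratMatrix hPQ

lemma card_primBall_le_two_mul_ncard (H : ℝ) :
    ((primBall (Fin n × Fin n) H).card : ℝ) ≤
      2 * (Set.ncard {P : Projectivization ℚ (Matrix (Fin n) (Fin n) ℚ) | heightLE P H} : ℝ) := by
  classical
  obtain ⟨g, hg⟩ := exists_primitive_representative n H
  have hfin := finite_heightLE n H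
  have hsub : primBall (Fin n × Fin n) H ⊆
      hfin.toFinset.biUnion fun P => {g P, -g P} := by
    intro A hA
    have hgA := (Finset.mem_filter.mp hA).2
    have h0 := ratMatrix_ne_zero (ne_zero_of_gcd_eq_one hgA)
    have hP : heightLE (Projectivization.mk ℚ (ratMatrix A) h0) H :=
      heightLE_iff.mpr ⟨A, hA, h0, rfl⟩
    obtain ⟨h1, h2, h3⟩ := hg _ hP
    rw [Finset.mem_biUnion]
    refine ⟨_, hfin.mem_toFinset.mpr hP, ?_⟩
    rw [Finset.mem_insert, Finset.mem_singleton]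
    exact eq_or_eq_neg_of_mk_eq hgA (Finset.mem_filter.mp h1).2 h0 h2 h3
  have hcard : (primBall (Fin n × Fin n) H).card ≤ hfin.toFinset.card * 2 :=
    (Finset.card_le_card hsub).trans
      (Finset.card_biUnion_le_card_mul _ _ _ fun P _ => Finset.card_le_two)
  rw [Set.ncard_eq_toFinset_card _ hfin, mul_comm]
  exact_mod_cast hcard

/-- Points of large condition number, counted with their two primitive representatives. -/
lemma two_mul_ncard_large_muP_le (hn : 2 ≤ n) {H ε : ℝ} (hH : 0 < H) (hε : 0 < ε) :
    2 * (Set.ncard {P : Projectivization ℚ (Matrix (Fin n) (Fin n) ℚ) |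
      heightLE P H ∧ ENNReal.ofReal (1 / ε) ≤ muP P} : ℝ) ≤
      n * (2 * (Real.sqrt n * (ε * H + 1 + n / 2)) *
      (Kvol (n ^ 2 - 1) * (H + n / 2) ^ (n ^ 2 - 1))) := by
  classical
  obtain ⟨g, hg⟩ := exists_primitive_representative n H
  have hfin : {P : Projectivization ℚ (Matrix (Fin n) (Fin n) ℚ) |
      heightLE P H ∧ ENNReal.ofReal (1 / ε) ≤ muP P}.Finite :=
    (finite_heightLE n H).subset fun P hP => hP.1
  have hcard : (hfin.toFinset.biUnion fun P => {g P, -g P}).card = hfin.toFinset.card * 2 := by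
    rw [Finset.card_biUnion, Finset.sum_const_nat (m := 2)]
    · intro P hP
      apply Finset.card_pair
      obtain ⟨h1, -, -⟩ := hg P (hfin.mem_toFinset.mp hP).1
      intro h
      exact ne_zero_of_gcd_eq_one (Finset.mem_filter.mp h1).2 (self_eq_neg.mp h)
    · intro P hP Q hQ hPQ
      obtain ⟨-, h1, e1⟩ := hg P (hfin.mem_toFinset.mp hP).1
      obtain ⟨-, h2, e2⟩ := hg Q (hfin.mem_toFinset.mp hQ).1
      have key : g P ≠ g Q ∧ g P ≠ -g Q := by
        refine ⟨fun h => hPQ ?_, fun h => hPQ ?_⟩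
        · rw [e1, e2, Projectivization.mk_eq_mk_iff']
          exact ⟨1, by rw [h, one_smul]⟩
        · rw [e1, e2, Projectivization.mk_eq_mk_iff']
          refine ⟨-1, ?_⟩
          rw [h]
          ext i j
          simp [ratMatrix]
      rw [Function.onFun, Finset.disjoint_left]
      intro A hA hA'
      simp only [Finset.mem_insert, Finset.mem_singleton] at hA hA'
      rcases hA with rfl | rfl <;> rcases hA' with h | h
      · exact key.1 h
      · exact key.2 h
      · exact key.2 (by rw [← h, neg_neg])
      · exact key.1 (neg_injective h)
  rw [Set.ncard_eq_toFinset_card _ hfin]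
  have hcast : 2 * (hfin.toFinset.card : ℝ) =
      ((hfin.toFinset.biUnion fun P => {g P, -g P}).card : ℝ) := by
    rw [hcard]
    push_cast
    ring
  rw [hcast]
  apply card_nearSingular_le hn hH.le (by positivity)
  intro A hA
  obtain ⟨P, hP, hAP⟩ := Finset.mem_biUnion.mp hA
  obtain ⟨hPH, hPμ⟩ := hfin.mem_toFinset.mp hP
  obtain ⟨h1, h2, e⟩ := hg P hPH
  have hgH := mem_intBall.mp (Finset.mem_filter.mp h1).1
  have hg' : ∃ v : Fin n → ℝ, l2 v = 1 ∧
      l2 (pairMulVec (fun q => (g P q : ℝ)) v) ≤ ε * H + 1 := by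
    have hε' : ε < ε + 1 / H := lt_add_of_pos_right _ (by positivity)
    obtain ⟨v, hv, hle⟩ := exists_small_image_of_le_muE hn hε hε' hPμ
    obtain ⟨a, ha⟩ := (Projectivization.mk_eq_mk_iff' ℚ _ _ P.rep_nonzero h2).mp
      (P.mk_rep.trans e)
    have ha0 : (a : ℝ) ≠ 0 := by
      intro h0
      apply P.rep_nonzero
      rw [← ha, Rat.cast_eq_zero.mp h0, zero_smul]
    have hentry : ∀ i j, ((P.rep i j : ℚ) : ℝ) = a * (g P (i, j) : ℝ) := by
      intro i j
      rw [← ha]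
      simp [ratMatrix]
    have hfrob : frobNorm (P.rep.map (Rat.cast : ℚ → ℝ)) =
        |(a : ℝ)| * l2 fun q => (g P q : ℝ) := by
      rw [frobNorm_eq_l2, ← l2_smul]
      congr 1
      funext q
      exact hentry q.1 q.2
    have hmul : (P.rep.map (Rat.cast : ℚ → ℝ)).mulVec v =
        (a : ℝ) • pairMulVec (fun q => (g P q : ℝ)) v := by
      funext i
      simp only [Matrix.mulVec, dotProduct, Matrix.map_apply, hentry, pairMulVec, Pi.smul_apply,
        smul_eq_mul, Finset.mul_sum, mul_assoc]
    refine ⟨v, hv, ?_⟩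
    rw [hfrob, hmul, l2_smul, mul_left_comm] at hle
    refine (le_of_mul_le_mul_left hle (abs_pos.mpr ha0)).trans ?_
    calc (ε + 1 / H) * l2 (fun q => (g P q : ℝ)) ≤ (ε + 1 / H) * H := by gcongr
      _ = ε * H + 1 := by field_simp
  simp only [Finset.mem_insert, Finset.mem_singleton] at hAP
  rcases hAP with rfl | rfl
  · exact ⟨hgH, hg'⟩
  · have hneg : (fun q => ((-g P) q : ℝ)) = (-1 : ℝ) • fun q => (g P q : ℝ) := by
      funext q
      simp
    obtain ⟨v, hv, hle⟩ := hg'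
    have hneg' : pairMulVec ((-1 : ℝ) • fun q => (g P q : ℝ)) v =
        (-1 : ℝ) • pairMulVec (fun q => (g P q : ℝ)) v := by
      funext a
      simp [pairMulVec]
    refine ⟨?_, v, hv, ?_⟩
    · rw [hneg, l2_smul]
      simpa using hgH
    · rw [hneg, hneg', l2_smul]
      simpa using hle

end Projective

section Comparison

variable {n : ℕ}

lemma Sfrak_ge {m : ℕ} (hm : 1 ≤ m) : m * Kvol (m - 1) ≤ Sfrak m := by
  have h := Finset.single_le_sum (f := fun ℓ => (m.choose ℓ : ℝ) * Kvol ℓ)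
    (s := Finset.range m) (fun ℓ _ => mul_nonneg (Nat.cast_nonneg _) (Kvol_pos ℓ).le)
    (Finset.mem_range.mpr (by omega : m - 1 < m))
  obtain ⟨k, rfl⟩ : ∃ k, m = k + 1 := ⟨m - 1, by omega⟩
  simpa [Sfrak] using h

lemma Cconst_nonneg (hn : 2 ≤ n) : 0 ≤ Cconst n := by
  have hN : 4 ≤ n ^ 2 := by nlinarith
  have h1 := one_le_zetaN (m := n ^ 2) (by omega)
  have h2 := one_le_zetaN (m := n ^ 2 - 1) (by omega)
  have h3 := Kvol_pos (n ^ 2)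
  have h4 : 0 ≤ Sfrak (n ^ 2) :=
    Finset.sum_nonneg fun ℓ _ => mul_nonneg (Nat.cast_nonneg _) (Kvol_pos ℓ).le
  unfold Cconst
  positivity

lemma mul_Kvol_div_le_Bconst (hn : 2 ≤ n) {ε : ℝ} (hε : 0 ≤ ε) :
    Tconst n * n ^ 2 / 2 * Kvol (n ^ 2 - 1) ≤ Bconst ε n * Kvol (n ^ 2) := by
  have hN : 4 ≤ n ^ 2 := by nlinarith
  have h1 := one_le_zetaN (m := n ^ 2) (by omega)
  have h2 := one_le_zetaN (m := n ^ 2 - 1) (by omega)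
  have h2' := zetaN_le_two (m := n ^ 2 - 1) (by omega)
  have hK := Kvol_pos (n ^ 2)
  have hK1 := Kvol_pos (n ^ 2 - 1)
  have hS := Sfrak_ge (m := n ^ 2) (by omega)
  have hT : 0 < Tconst n := lt_of_lt_of_le (by positivity) (Tconst_ge hn)
  push_cast at hS
  have hS0 : 0 ≤ Sfrak (n ^ 2) := le_trans (by positivity) hS
  calc Tconst n * n ^ 2 / 2 * Kvol (n ^ 2 - 1)
      = Tconst n * (n ^ 2 * Kvol (n ^ 2 - 1)) / 2 := by ring
    _ ≤ Tconst n * Sfrak (n ^ 2) / zetaN (n ^ 2 - 1) := by gcongr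
    _ = 1 * (Tconst n * Sfrak (n ^ 2) / (Kvol (n ^ 2) * zetaN (n ^ 2 - 1))) * Kvol (n ^ 2) := by
        field_simp
    _ ≤ Bconst ε n * Kvol (n ^ 2) := by
        unfold Bconst
        gcongr
        rw [add_assoc]
        apply le_add_of_le_of_nonneg _ (by positivity)
        gcongr
        exact le_add_of_nonneg_right (by positivity)

lemma Kvol_pred_bounds (hn : 2 ≤ n) :
    Kvol (n ^ 2) ≤ 2 * Kvol (n ^ 2 - 1) ∧ 2.002 * Kvol (n ^ 2 - 1) ≤ 0.9 * n * Kvol (n ^ 2) := by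
  have hN : 4 ≤ n ^ 2 := by nlinarith
  obtain ⟨m, hm⟩ : ∃ m, n ^ 2 = m + 1 := ⟨n ^ 2 - 1, by omega⟩
  have hm' : (m : ℝ) + 1 = (n : ℝ) ^ 2 := by exact_mod_cast hm.symm
  have hm3 : (3 : ℝ) ≤ m := by exact_mod_cast (by omega : 3 ≤ m)
  have h1 := Kvol_sq_le m
  have h2 := le_Kvol_sq m
  have hK := Kvol_pos (m + 1)
  have hK1 := Kvol_pos m
  have hpi := Real.pi_gt_d2
  have hpi' := Real.pi_lt_d2
  rw [hm, Nat.add_sub_cancel]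
  have hK2 : 0 < Kvol (m + 1) ^ 2 := by positivity
  have hK12 : 0 < Kvol m ^ 2 := by positivity
  constructor
  · refine (sq_le_sq₀ hK.le (by positivity)).mp ?_
    have h3 : 4 * Kvol (m + 1) ^ 2 ≤ (m + 1) * Kvol (m + 1) ^ 2 := by
      gcongr
      linarith
    have h4 : 2 * Real.pi * Kvol m ^ 2 ≤ 2 * 3.15 * Kvol m ^ 2 := by gcongr
    rw [mul_pow]
    linarith
  · refine (sq_le_sq₀ (by positivity) (by positivity)).mp ?_
    have e : (0.9 * n * Kvol (m + 1)) ^ 2 = 0.81 * ((m + 1) * Kvol (m + 1) ^ 2) := by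
      rw [hm']
      ring
    have h3 : ((m : ℝ) + 2) * Kvol (m + 1) ^ 2 ≤ 1.25 * (m + 1) * Kvol (m + 1) ^ 2 := by
      gcongr
      linarith
    have h4 : 2 * 3.14 * Kvol m ^ 2 ≤ 2 * Real.pi * Kvol m ^ 2 := by gcongr
    rw [e, mul_pow]
    linarith

lemma Tconst_le_Bconst (hn : 2 ≤ n) {ε : ℝ} (hε : 0 ≤ ε) : Tconst n ≤ Bconst ε n := by
  have h := mul_Kvol_div_le_Bconst hn hε
  have hK := (Kvol_pred_bounds hn).1
  have hT : 0 < Tconst n := lt_of_lt_of_le (by positivity) (Tconst_ge hn)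
  have hn2 : (4 : ℝ) ≤ (n : ℝ) ^ 2 := by exact_mod_cast (by nlinarith : 4 ≤ n ^ 2)
  have hK1 := Kvol_pos (n ^ 2 - 1)
  refine le_of_mul_le_mul_right (le_trans ?_ h) (Kvol_pos (n ^ 2))
  calc Tconst n * Kvol (n ^ 2) ≤ Tconst n * (2 * Kvol (n ^ 2 - 1)) := by gcongr
    _ = Tconst n * 4 / 2 * Kvol (n ^ 2 - 1) := by ring
    _ ≤ _ := by gcongr

lemma nine_tenths_le_card_primBall (hn : 2 ≤ n) {H : ℝ} (hH : 500000 * (n : ℝ) ^ 4 ≤ H) :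
    Kvol (n ^ 2) * (0.9 * H ^ (n ^ 2)) ≤ ((primBall (Fin n × Fin n) H).card : ℝ) := by
  have hn' : (2 : ℝ) ≤ n := by exact_mod_cast hn
  have hcard : Fintype.card (Fin n × Fin n) = n ^ 2 := by simp [sq]
  have : Nonempty (Fin n × Fin n) := ⟨(⟨0, by omega⟩, ⟨0, by omega⟩)⟩
  have hn4 : (n : ℝ) ≤ (n : ℝ) ^ 4 := le_self_pow₀ (by linarith) (by norm_num)
  have hs : Real.sqrt ((n ^ 2 : ℕ) : ℝ) = n := by
    rw [Nat.cast_pow, Real.sqrt_sq (by positivity)]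
  have h := le_card_primBall (ι := Fin n × Fin n) (H := H) (by linarith)
    (by rw [hcard, hs]; linarith)
  rw [hcard, hs] at h
  refine le_trans ?_ h
  have hK := Kvol_pos (n ^ 2)
  gcongr
  exact primitive_main_term hn hH

/-- The upper bound for points of large condition number against the lower bound for all points. -/
lemma counting_bounds_compare (hn : 2 ≤ n) {H ε : ℝ} (hε : 0 ≤ ε)
    (hH : 500000 * (n : ℝ) ^ 4 ≤ H) :
    n * (2 * (Real.sqrt n * (ε * H + 1 + n / 2)) *
      (Kvol (n ^ 2 - 1) * (H + n / 2) ^ (n ^ 2 - 1))) ≤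
    (ε * (n : ℝ) ^ ((5 : ℝ) / 2) + Bconst ε n / H) * (Kvol (n ^ 2) * (0.9 * H ^ (n ^ 2))) := by
  have hn' : (2 : ℝ) ≤ n := by exact_mod_cast hn
  have hN : 4 ≤ n ^ 2 := by nlinarith
  have hHpos : 0 < H := lt_of_lt_of_le (by positivity) hH
  have hn3 : (0 : ℝ) < (n : ℝ) ^ 3 := by positivity
  have hH3 : 1000000 * (n : ℝ) ^ 3 ≤ H := by nlinarith
  have hB := mul_Kvol_div_le_Bconst hn hε
  have hK2 := (Kvol_pred_bounds hn).2
  have hT := Tconst_ge hn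
  have hK := Kvol_pos (n ^ 2)
  have hK1 := Kvol_pos (n ^ 2 - 1)
  obtain ⟨m, hm⟩ : ∃ m, n ^ 2 = m + 1 := ⟨n ^ 2 - 1, by omega⟩
  have hm' : (m : ℝ) + 1 = (n : ℝ) ^ 2 := by exact_mod_cast hm.symm
  have hrpow : (n : ℝ) ^ ((5 : ℝ) / 2) = n ^ 2 * Real.sqrt n := by
    rw [Real.sqrt_eq_rpow, ← Real.rpow_natCast, ← Real.rpow_add (by linarith)]
    norm_num
  have hsq : Real.sqrt n ≤ n := by
    rw [Real.sqrt_le_left (by linarith)]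
    nlinarith
  have hpow : (H + n / 2) ^ m ≤ 1.001 * H ^ m := by
    have hx0 : 0 ≤ (n : ℝ) / (2 * H) := by positivity
    have hx : (m : ℝ) * (n / (2 * H)) ≤ 1 / 2000000 := by
      calc (m : ℝ) * (n / (2 * H)) ≤ (n : ℝ) ^ 2 * (n / (2 * H)) := by
            gcongr
            linarith
        _ = (n : ℝ) ^ 3 / (2 * H) := by ring
        _ ≤ 1 / 2000000 := by
            rw [div_le_div_iff₀ (by positivity) (by norm_num)]
            linarith
    have hx1 : (n : ℝ) / (2 * H) ≤ 1 := by
      rw [div_le_one (by positivity)]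
      nlinarith
    set x := (n : ℝ) / (2 * H) with hxdef
    have h1 := one_add_mul_le_pow (a := -x) (by linarith) m
    have h2 : (1 + x) ^ m * (1 + -x) ^ m ≤ 1 := by
      rw [← mul_pow]
      exact pow_le_one₀ (by nlinarith) (by nlinarith)
    have h3 : (1 + x) ^ m ≤ 1.001 := by
      have h4 : 0 < (1 + x) ^ m := by positivity
      have h5 : 0.9999 ≤ (1 + -x) ^ m := by linarith
      nlinarith
    have e : H + n / 2 = (1 + x) * H := by
      rw [hxdef]
      field_simp
    rw [e, mul_pow]
    gcongr
  have e1 : n ^ 2 - 1 = m := by omega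
  rw [hrpow]
  rw [e1] at hB hK2 hK1 ⊢
  have hHm : 0 < H ^ m := by positivity
  calc n * (2 * (Real.sqrt n * (ε * H + 1 + n / 2)) * (Kvol m * (H + n / 2) ^ m))
      ≤ n * (2 * (Real.sqrt n * (ε * H + 1 + n / 2)) * (Kvol m * (1.001 * H ^ m))) := by gcongr
    _ = (ε * H * n * Real.sqrt n * (2.002 * Kvol m) +
          2.002 * n * Real.sqrt n * (1 + n / 2) * Kvol m) * H ^ m := by ring
    _ ≤ (ε * H * n * Real.sqrt n * (0.9 * n * Kvol (n ^ 2)) +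
          0.9 * (Bconst ε n * Kvol (n ^ 2))) * H ^ m := by
        gcongr ?_ * _
        apply add_le_add
        · gcongr
        · calc 2.002 * n * Real.sqrt n * (1 + n / 2) * Kvol m
              ≤ 2.002 * n * n * (1 + n / 2) * Kvol m := by gcongr
            _ = (2.002 * (1 + n / 2)) * (n ^ 2 * Kvol m) := by ring
            _ ≤ (0.45 * Tconst n) * (n ^ 2 * Kvol m) := by
                have h4 : (n : ℝ) ≤ (n : ℝ) ^ 4 := le_self_pow₀ (by linarith) (by norm_num)
                exact mul_le_mul_of_nonneg_right (by linarith) (by positivity)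
            _ = 0.9 * (Tconst n * n ^ 2 / 2 * Kvol m) := by ring
            _ ≤ _ := by gcongr
    _ = (ε * (n ^ 2 * Real.sqrt n) + Bconst ε n / H) *
          (Kvol (n ^ 2) * (0.9 * H ^ (m + 1))) := by
        rw [pow_succ H m]
        field_simp
    _ = _ := by rw [← hm]

end Comparison

/-- for `n ≥ 2`, `H ≥ 1`, `ε > 0` and `H > C(n)`,
`𝒩(ε,H)/𝒩(1,H) ≤ ε·n^{5/2} + B(ε,n)/(H − C(n))`. -/
theorem probability_mu_large :
    ∀ (n : ℕ), 2 ≤ n → ∀ H ε : ℝ, 1 ≤ H → 0 < ε → Cconst n < H →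
      (Set.ncard {P : Projectivization ℚ (Matrix (Fin n) (Fin n) ℚ) |
          heightLE P H ∧ ENNReal.ofReal (1 / ε) ≤ muP P} : ℝ) ≤
        (ε * (n : ℝ) ^ ((5 : ℝ) / 2) + Bconst ε n / (H - Cconst n)) *
          (Set.ncard {P : Projectivization ℚ (Matrix (Fin n) (Fin n) ℚ) |
            heightLE P H} : ℝ) := by
  intro n hn H ε hH1 hε hC
  have hsub : Set.ncard {P : Projectivization ℚ (Matrix (Fin n) (Fin n) ℚ) |
      heightLE P H ∧ ENNReal.ofReal (1 / ε) ≤ muP P} ≤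
      Set.ncard {P : Projectivization ℚ (Matrix (Fin n) (Fin n) ℚ) | heightLE P H} :=
    Set.ncard_le_ncard (fun P hP => hP.1) (finite_heightLE n H)
  rcases le_or_gt 1 (ε * (n : ℝ) ^ ((5 : ℝ) / 2) + Bconst ε n / (H - Cconst n)) with h1 | h1
  · refine le_trans ?_ (le_mul_of_one_le_left (Nat.cast_nonneg _) h1)
    exact_mod_cast hsub
  have hHpos : 0 < H := by linarith
  have hHC : 0 < H - Cconst n := sub_pos.mpr hC
  have hCnn := Cconst_nonneg hn
  have hBT := Tconst_le_Bconst hn hε.le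
  have hT := Tconst_ge hn
  have hTpos : 0 < Tconst n := lt_of_lt_of_le (by positivity) hT
  have hBpos : 0 < Bconst ε n := hTpos.trans_le hBT
  have hHB : Bconst ε n < H := by
    have h2 : 0 ≤ ε * (n : ℝ) ^ ((5 : ℝ) / 2) := by positivity
    have h3 : Bconst ε n / (H - Cconst n) < 1 := by linarith
    rw [div_lt_one hHC] at h3
    linarith
  have hHT : 500000 * (n : ℝ) ^ 4 ≤ H := by linarith
  have hX := two_mul_ncard_large_muP_le hn hHpos hε
  have hY := (nine_tenths_le_card_primBall hn hHT).trans (card_primBall_le_two_mul_ncard H)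
  have hmain := counting_bounds_compare hn hε.le hHT
  have hcoef : ε * (n : ℝ) ^ ((5 : ℝ) / 2) + Bconst ε n / H ≤
      ε * (n : ℝ) ^ ((5 : ℝ) / 2) + Bconst ε n / (H - Cconst n) := by
    gcongr
    linarith
  have hfinal := mul_le_mul hcoef hY (by have := Kvol_pos (n ^ 2); positivity) (by positivity)
  linarith

end
end

section
/- Let n ≥ 2, let H ≥ 1 and ε > 0 be real numbers, and let N(ε,H) := #(R(ε,H) ∩ M_n(ℤ)) be the number of integer matrices in R(ε,H). Then |N(ε,H) − Vol(R(ε,H))| ≤ T_n·𝔖^{(n²)}·H^{n²−1}, where T_n := (2·max{4,n})^{2n⁴+4n²} and 𝔖^{(n²)} := Σ_{ℓ=0}^{n²−1} C(n²,ℓ)·K_ℓ. -/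
open scoped ENNReal
open MeasureTheory

noncomputable section

instance {n : ℕ} : MeasureSpace (Matrix (Fin n) (Fin n) ℝ) :=
  inferInstanceAs (MeasureSpace (Fin n → Fin n → ℝ))

/-- Frobenius (Euclidean) inner product of matrices. -/
def frobInner {n : ℕ} (A B : Matrix (Fin n) (Fin n) ℝ) : ℝ := ∑ i, ∑ j, A i j * B i j

/-- The Fubini–Study distance, expressed on representatives. -/
def dFS {n : ℕ} (A B : Matrix (Fin n) (Fin n) ℝ) : ℝ :=
  Real.sin (Real.arccos (|frobInner A B| / (frobNorm A * frobNorm B)))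

/-- Fubini–Study distance from (the projective class of) `M` to the projective variety
`Ŝ = π(S \ {0})` of singular matrices. -/
def rhoSing {n : ℕ} (M : Matrix (Fin n) (Fin n) ℝ) : ℝ :=
  sInf {t : ℝ | ∃ S : Matrix (Fin n) (Fin n) ℝ, S ≠ 0 ∧ ¬ IsUnit S.det ∧ t = dFS M S}

/-- `R(ε,H) = B(0,H) ∩ (π⁻¹(Ŝ(ε)) ∪ {0})`. -/
def Rset (n : ℕ) (ε H : ℝ) : Set (Matrix (Fin n) (Fin n) ℝ) :=
  {M | frobNorm M ≤ H} ∩ {M | M = 0 ∨ rhoSing M ≤ ε}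

/-- A preconnected set avoiding the frontier of `D` lies in `D` or is disjoint from it. -/
lemma IsPreconnected.subset_or_disjoint_of_disjoint_frontier {X : Type*} [TopologicalSpace X]
    {s D : Set X} (hs : IsPreconnected s) (h : Disjoint s (frontier D)) :
    s ⊆ D ∨ Disjoint s D := by
  by_contra! hcon
  obtain ⟨h₁, h₂⟩ := hcon
  have h₃ : (s ∩ D).Nonempty := Set.not_disjoint_iff_nonempty_inter.1 h₂
  have h₄ : (s ∩ Dᶜ).Nonempty := by
    obtain ⟨x, hx, hxD⟩ := Set.not_subset.1 h₁
    exact ⟨x, hx, hxD⟩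
  have hcover : s ⊆ interior D ∪ (closure D)ᶜ := fun x hx => by
    by_contra hx'
    simp only [Set.mem_union, Set.mem_compl_iff, not_or, not_not] at hx'
    exact Set.disjoint_left.1 h hx ⟨hx'.2, hx'.1⟩
  obtain ⟨x, hxs, hxi, hxc⟩ := hs _ _ isOpen_interior isClosed_closure.isOpen_compl hcover
    (by
      obtain ⟨x, hx, hxD⟩ := h₃
      exact ⟨x, hx, (hcover hx).resolve_right fun hc => hc (subset_closure hxD)⟩)
    (by
      obtain ⟨x, hx, hxD⟩ := h₄
      exact ⟨x, hx, (hcover hx).resolve_left fun hc => hxD (interior_subset hc)⟩)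
  exact hxc (interior_subset_closure hxi)

lemma measurableSet_floor_mem (B : Finset ℤ) : MeasurableSet {t : ℝ | ⌊t⌋ ∈ B} :=
  Int.measurable_floor (B.measurableSet)

lemma setOf_floor_mem_eq_biUnion (B : Finset ℤ) :
    {t : ℝ | ⌊t⌋ ∈ B} = ⋃ z ∈ B, Set.Ico (z : ℝ) (z + 1) := by
  ext t
  simp only [Set.mem_ofPred_eq, Set.mem_iUnion, exists_prop]
  constructor
  · intro h
    exact ⟨_, h, Int.floor_le t, Int.lt_floor_add_one t⟩
  · rintro ⟨z, hz, h⟩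
    rwa [Int.floor_eq_iff.2 ⟨h.1, h.2⟩]

lemma pairwiseDisjoint_Ico_intCast (B : Finset ℤ) :
    (B : Set ℤ).PairwiseDisjoint fun z => Set.Ico (z : ℝ) (z + 1) := by
  intro a _ b _ hab
  refine Set.disjoint_left.2 fun t ha hb => hab ?_
  rw [← Int.floor_eq_iff.2 ⟨ha.1, ha.2⟩, ← Int.floor_eq_iff.2 ⟨hb.1, hb.2⟩]

lemma volume_setOf_floor_mem (B : Finset ℤ) : volume {t : ℝ | ⌊t⌋ ∈ B} = B.card := by
  rw [setOf_floor_mem_eq_biUnion, measure_biUnion_finset (pairwiseDisjoint_Ico_intCast B)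
    (fun _ _ => measurableSet_Ico)]
  simp

/-- A subset of the line with at most `k` frontier points has as many integer points as its
length, up to `k`. -/
lemma abs_sum_indicator_sub_volume_le {D : Set ℝ} (hD : MeasurableSet D) {B : Finset ℤ}
    (hDB : ∀ t ∈ D, ⌊t⌋ ∈ B) {F : Finset ℝ} (hF : frontier D ⊆ F) :
    |∑ z ∈ B, D.indicator (1 : ℝ → ℝ) z - volume.real D| ≤ F.card := by
  have hsplit : volume.real D = ∑ z ∈ B, volume.real (D ∩ Set.Ico (z : ℝ) (z + 1)) := by
    rw [← measureReal_biUnion_finset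
      ((pairwiseDisjoint_Ico_intCast B).mono fun _ => Set.inter_subset_right)
      (fun _ _ => hD.inter measurableSet_Ico)
      (fun _ _ => ((measure_mono Set.inter_subset_right).trans_lt measure_Ico_lt_top).ne),
      ← Set.inter_iUnion₂, ← setOf_floor_mem_eq_biUnion]
    exact congrArg _ (Set.inter_eq_left.2 hDB).symm
  have hIco : ∀ z : ℤ, volume.real (Set.Ico (z : ℝ) (z + 1)) = 1 := fun z => by
    simp [measureReal_def]
  have hterm : ∀ z ∈ B, |D.indicator (1 : ℝ → ℝ) z - volume.real (D ∩ Set.Ico (z : ℝ) (z + 1))| ≤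
      if z ∈ F.image Int.floor then 1 else 0 := by
    intro z _
    have hmem : (z : ℝ) ∈ Set.Ico (z : ℝ) (z + 1) := by simp
    split_ifs with hz
    · have h₁ : volume.real (D ∩ Set.Ico (z : ℝ) (z + 1)) ≤ 1 :=
        (measureReal_mono Set.inter_subset_right measure_Ico_lt_top.ne).trans_eq (hIco z)
      have h₂ : 0 ≤ volume.real (D ∩ Set.Ico (z : ℝ) (z + 1)) := measureReal_nonneg
      by_cases hzD : (z : ℝ) ∈ D
      · rw [Set.indicator_of_mem hzD, Pi.one_apply, abs_le]
        constructor <;> linarith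
      · rw [Set.indicator_of_notMem hzD, abs_le]
        constructor <;> linarith
    · have hdisj : Disjoint (Set.Ico (z : ℝ) (z + 1)) (frontier D) := by
        refine Set.disjoint_left.2 fun t ht htF => hz ?_
        exact Finset.mem_image.2 ⟨t, hF htF, Int.floor_eq_iff.2 ⟨ht.1, ht.2⟩⟩
      rcases isPreconnected_Ico.subset_or_disjoint_of_disjoint_frontier hdisj with h | h
      · rw [Set.inter_eq_right.2 h, hIco, Set.indicator_of_mem (h hmem)]
        simp
      · rw [h.symm.inter_eq, Set.indicator_of_notMem (Set.disjoint_left.1 h hmem)]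
        simp
  rw [hsplit, ← Finset.sum_sub_distrib]
  calc _ ≤ ∑ z ∈ B, if z ∈ F.image Int.floor then (1 : ℝ) else 0 :=
        (Finset.abs_sum_le_sum_abs _ _).trans (Finset.sum_le_sum hterm)
    _ = ((B.filter (· ∈ F.image Int.floor)).card : ℝ) := by simp
    _ ≤ F.card := by
        norm_cast
        exact (Finset.card_le_card fun z hz => (Finset.mem_filter.1 hz).2).trans
          Finset.card_image_le

/-- Every line parallel to a coordinate axis meets `A` in a set with at most `h` frontier points. -/
def AxisFrontierBound {ι : Type*} [DecidableEq ι] (h : ℕ) (A : Set (ι → ℝ)) : Prop :=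
  ∀ x i, ∃ F : Finset ℝ, F.card ≤ h ∧ frontier {t | Function.update x i t ∈ A} ⊆ F

lemma sum_piFinset_fin_succ {m : ℕ} (B : Finset ℤ) (f : (Fin (m + 1) → ℤ) → ℝ) :
    ∑ z ∈ Fintype.piFinset (fun _ : Fin (m + 1) => B), f z =
      ∑ a ∈ B, ∑ w ∈ Fintype.piFinset (fun _ : Fin m => B), f (Fin.cons a w) := by
  rw [← Finset.sum_product']
  refine Finset.sum_nbij' (fun z => (z 0, Fin.tail z)) (fun p => Fin.cons p.1 p.2) ?_ ?_ ?_ ?_ ?_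
  · intro z hz
    simp only [Fintype.mem_piFinset, Finset.mem_product] at hz ⊢
    exact ⟨hz 0, fun i => hz i.succ⟩
  · intro p hp
    simp only [Fintype.mem_piFinset, Finset.mem_product] at hp ⊢
    intro i
    refine Fin.cases ?_ (fun i => ?_) i
    · exact hp.1
    · exact hp.2 i
  · intro z _
    exact Fin.cons_self_tail z
  · intro p _
    simp
  · intro z _
    simp

lemma measurable_fin_cons {m : ℕ} :
    Measurable fun p : ℝ × (Fin m → ℝ) => (Fin.cons p.1 p.2 : Fin (m + 1) → ℝ) := by
  refine measurable_pi_lambda _ fun i => ?_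
  refine Fin.cases ?_ (fun i => ?_) i
  · simpa using measurable_fst
  · simpa [Function.comp_def] using (measurable_pi_apply i).comp measurable_snd

lemma measurePreserving_fin_cons {m : ℕ} :
    MeasurePreserving (fun p : ℝ × (Fin m → ℝ) => (Fin.cons p.1 p.2 : Fin (m + 1) → ℝ)) := by
  have := (volume_preserving_piFinSuccAbove (fun _ : Fin (m + 1) => ℝ) 0).symm
  convert this using 1
  ext p : 1
  simp [MeasurableEquiv.piFinSuccAbove, Fin.consEquiv]

lemma integrable_indicator_one {α : Type*} [MeasurableSpace α] {μ : Measure α} {s : Set α}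
    (hs : MeasurableSet s) (hfin : μ s ≠ ∞) : Integrable (s.indicator (1 : α → ℝ)) μ :=
  (integrable_indicator_iff hs).2 (integrableOn_const (C := (1 : ℝ)) hfin)

/-- Discrepancy between the number of integer points and the volume of a bounded set, under a
uniform bound for the number of frontier points on each line parallel to an axis. -/
theorem abs_sum_indicator_sub_volume_le_of_axisFrontierBound {h : ℕ} {B : Finset ℤ} :
    ∀ {m : ℕ} {A : Set (Fin m → ℝ)}, MeasurableSet A → (∀ x ∈ A, ∀ i, ⌊x i⌋ ∈ B) →
      AxisFrontierBound h A →
      |∑ z ∈ Fintype.piFinset (fun _ : Fin m => B), A.indicator (1 : (Fin m → ℝ) → ℝ)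
          (fun i => (z i : ℝ)) - volume.real A| ≤ m * h * (B.card : ℝ) ^ (m - 1)
  | 0, A, _, _, _ => by
    have hvol : volume.real A = A.indicator (1 : (Fin 0 → ℝ) → ℝ) 0 := by
      rcases A.eq_empty_or_nonempty with rfl | hne
      · simp
      · rw [Subsingleton.eq_univ_of_nonempty hne]
        simp [measureReal_def, volume_pi]
    have : ∀ z : Fin 0 → ℤ, (fun i => (z i : ℝ)) = 0 := fun z => Subsingleton.elim _ _
    simp only [this, hvol]
    simp
  | m + 1, A, hA, hAB, hAF => by
    set box : Set (Fin m → ℝ) := Set.univ.pi fun _ => {t : ℝ | ⌊t⌋ ∈ B} with hbox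
    have hboxm : MeasurableSet box := MeasurableSet.univ_pi fun _ => measurableSet_floor_mem B
    have hboxv : volume box = (B.card : ℝ≥0∞) ^ m := by
      rw [hbox, volume_pi_pi]
      simp [volume_setOf_floor_mem]
    have hboxfin : volume box ≠ ∞ := by rw [hboxv]; finiteness
    have hboxr : volume.real box = (B.card : ℝ) ^ m := by simp [measureReal_def, hboxv]
    -- sections of `A`
    set P : Set (ℝ × (Fin m → ℝ)) := (fun p => (Fin.cons p.1 p.2 : Fin (m + 1) → ℝ)) ⁻¹' A with hP
    have hPm : MeasurableSet P := measurable_fin_cons hA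
    have hslice : ∀ t : ℝ, MeasurableSet (Prod.mk t ⁻¹' P) := fun t => measurable_prodMk_left hPm
    have hline : ∀ y, MeasurableSet ((fun t => (t, y)) ⁻¹' P) := fun y => measurable_prodMk_right hPm
    have hslicebox : ∀ t, Prod.mk t ⁻¹' P ⊆ box := fun t y hy i _ => by
      simpa using hAB _ hy i.succ
    have hvolA : volume.real A = volume.real P := by
      rw [measureReal_def, measureReal_def, hP,
        measurePreserving_fin_cons.measure_preimage hA.nullMeasurableSet]
    have hPfin : volume P ≠ ∞ := by
      have : P ⊆ {t : ℝ | ⌊t⌋ ∈ B} ×ˢ box := fun p hp =>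
        ⟨by simpa using hAB _ hp 0, hslicebox p.1 hp⟩
      refine ((measure_mono this).trans_lt ?_).ne
      rw [Measure.volume_eq_prod, Measure.prod_prod, hboxv, volume_setOf_floor_mem]
      finiteness
    have hPint : Integrable (P.indicator (1 : ℝ × (Fin m → ℝ) → ℝ)) (volume : Measure (ℝ × (Fin m → ℝ))) :=
      integrable_indicator_one hPm hPfin
    have hlineeq : ∀ y, ∫ t, P.indicator (1 : ℝ × (Fin m → ℝ) → ℝ) (t, y) =
        volume.real ((fun t => (t, y)) ⁻¹' P) := fun y => by
      rw [← integral_indicator_one (hline y)]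
      rfl
    have hPvol : volume.real P = ∫ y, volume.real ((fun t => (t, y)) ⁻¹' P) := by
      rw [← integral_indicator_one hPm, Measure.volume_eq_prod, integral_prod_symm _ hPint]
      exact integral_congr_ae (.of_forall hlineeq)
    have hPline : Integrable fun y => volume.real ((fun t => (t, y)) ⁻¹' P) := by
      have := hPint.integral_prod_right
      exact this.congr (.of_forall hlineeq)
    have hsliceint : ∀ a : ℤ, Integrable ((Prod.mk (a : ℝ) ⁻¹' P).indicator (1 : (Fin m → ℝ) → ℝ)) := fun a =>
      integrable_indicator_one (hslice a) ((measure_mono (hslicebox a)).trans_lt hboxfin.lt_top).ne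
    -- the induction hypothesis on the slices
    have hind : ∀ a ∈ B,
        |∑ w ∈ Fintype.piFinset (fun _ : Fin m => B), (Prod.mk (a : ℝ) ⁻¹' P).indicator
          (1 : (Fin m → ℝ) → ℝ) (fun i => (w i : ℝ)) - volume.real (Prod.mk (a : ℝ) ⁻¹' P)| ≤
          m * h * (B.card : ℝ) ^ (m - 1) := by
      intro a _
      refine abs_sum_indicator_sub_volume_le_of_axisFrontierBound (hslice a)
        (fun x hx i => by simpa using hAB _ hx i.succ) fun x i => ?_
      obtain ⟨F, hFc, hF⟩ := hAF (Fin.cons (a : ℝ) x) i.succ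
      refine ⟨F, hFc, ?_⟩
      simp only [← Fin.cons_update] at hF
      exact hF
    -- integrating over the lines
    have hlines : |∑ a ∈ B, volume.real (Prod.mk (a : ℝ) ⁻¹' P) - volume.real P| ≤
        h * (B.card : ℝ) ^ m := by
      have hsum : ∑ a ∈ B, volume.real (Prod.mk (a : ℝ) ⁻¹' P) =
          ∫ y, ∑ a ∈ B, (Prod.mk (a : ℝ) ⁻¹' P).indicator (1 : (Fin m → ℝ) → ℝ) y := by
        rw [integral_finsetSum _ fun a _ => hsliceint a]
        exact Finset.sum_congr rfl fun a _ => (integral_indicator_one (hslice a)).symm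
      rw [hsum, hPvol, ← integral_sub (integrable_finsetSum _ fun a _ => hsliceint a) hPline]
      have hpt : ∀ y, ‖∑ a ∈ B, (Prod.mk (a : ℝ) ⁻¹' P).indicator (1 : (Fin m → ℝ) → ℝ) y -
          volume.real ((fun t => (t, y)) ⁻¹' P)‖ ≤ box.indicator (fun _ => (h : ℝ)) y := by
        intro y
        by_cases hy : y ∈ box
        · rw [Set.indicator_of_mem hy, Real.norm_eq_abs]
          obtain ⟨F, hFc, hF⟩ := hAF (Fin.cons 0 y) 0
          refine (abs_sum_indicator_sub_volume_le (hline y)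
            (fun t ht => by simpa using hAB _ ht 0) (F := F) ?_).trans (by exact_mod_cast hFc)
          simp only [Fin.update_cons_zero] at hF
          exact hF
        · have h₁ : ∀ t, (t, y) ∉ P := fun t ht => hy (hslicebox t ht)
          have h₂ : (fun t => (t, y)) ⁻¹' P = ∅ := Set.eq_empty_of_forall_notMem h₁
          rw [Set.indicator_of_notMem hy, h₂, Finset.sum_eq_zero]
          · simp
          · intro a _
            exact Set.indicator_of_notMem (s := Prod.mk (a : ℝ) ⁻¹' P) (h₁ a) _
      refine (norm_integral_le_of_norm_le
        ((integrable_indicator_iff hboxm).2 (integrableOn_const hboxfin)) (.of_forall hpt)).trans_eq ?_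
      rw [integral_indicator_const _ hboxm, hboxr, smul_eq_mul, mul_comm]
    have hcount : ∑ z ∈ Fintype.piFinset (fun _ : Fin (m + 1) => B),
        A.indicator (1 : (Fin (m + 1) → ℝ) → ℝ) (fun i => (z i : ℝ)) =
        ∑ a ∈ B, ∑ w ∈ Fintype.piFinset (fun _ : Fin m => B),
          (Prod.mk (a : ℝ) ⁻¹' P).indicator (1 : (Fin m → ℝ) → ℝ) (fun i => (w i : ℝ)) := by
      rw [sum_piFinset_fin_succ]
      refine Finset.sum_congr rfl fun a _ => Finset.sum_congr rfl fun w _ => ?_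
      have : (fun i => ((Fin.cons a w : Fin (m + 1) → ℤ) i : ℝ)) =
          Fin.cons (a : ℝ) fun i => (w i : ℝ) := by
        ext i
        refine Fin.cases ?_ (fun i => ?_) i <;> simp
      rw [this]
      rfl
    have hslices : |∑ a ∈ B, ∑ w ∈ Fintype.piFinset (fun _ : Fin m => B),
          (Prod.mk (a : ℝ) ⁻¹' P).indicator (1 : (Fin m → ℝ) → ℝ) (fun i => (w i : ℝ)) -
          ∑ a ∈ B, volume.real (Prod.mk (a : ℝ) ⁻¹' P)| ≤ m * h * (B.card : ℝ) ^ m := by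
      rw [← Finset.sum_sub_distrib]
      refine ((Finset.abs_sum_le_sum_abs _ _).trans (Finset.sum_le_sum hind)).trans_eq ?_
      rw [Finset.sum_const, nsmul_eq_mul]
      rcases m with _ | m
      · simp
      · rw [Nat.add_sub_cancel, pow_succ]
        ring
    rw [hcount, hvolA]
    refine (abs_sub_le _ _ _).trans ((add_le_add hslices hlines).trans_eq ?_)
    rw [Nat.add_sub_cancel]
    push_cast
    ring

open scoped Matrix

/-- `MᵀM - c‖M‖²·1`. For `c = ε²` it is positive definite exactly when `M` has relative distance
more than `ε` from the singular matrices. -/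
def gramShift {R : Type*} [CommRing R] {n : ℕ} (c : R) (M : Matrix (Fin n) (Fin n) R) :
    Matrix (Fin n) (Fin n) R :=
  Mᵀ * M - Matrix.diagonal fun _ => c * ∑ i, ∑ j, M i j ^ 2

lemma frobInner_self {n : ℕ} (M : Matrix (Fin n) (Fin n) ℝ) :
    frobInner M M = ∑ i, ∑ j, M i j ^ 2 := by
  simp [frobInner, sq]

lemma frobInner_self_nonneg {n : ℕ} (M : Matrix (Fin n) (Fin n) ℝ) : 0 ≤ frobInner M M := by
  rw [frobInner_self]
  positivity

lemma frobInner_self_pos {n : ℕ} {M : Matrix (Fin n) (Fin n) ℝ} (hM : M ≠ 0) :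
    0 < frobInner M M := by
  refine (frobInner_self_nonneg M).lt_of_ne' fun h => hM ?_
  rw [frobInner_self, Finset.sum_eq_zero_iff_of_nonneg fun _ _ => by positivity] at h
  ext i j
  have hi := h i (Finset.mem_univ i)
  rw [Finset.sum_eq_zero_iff_of_nonneg fun _ _ => by positivity] at hi
  simpa using hi j (Finset.mem_univ j)

lemma frobInner_sub_smul_self {n : ℕ} (M S : Matrix (Fin n) (Fin n) ℝ) (c : ℝ) :
    frobInner (M - c • S) (M - c • S) =
      frobInner M M - 2 * c * frobInner M S + c ^ 2 * frobInner S S := by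
  simp only [frobInner, Finset.mul_sum, ← Finset.sum_sub_distrib, ← Finset.sum_add_distrib]
  refine Finset.sum_congr rfl fun i _ => Finset.sum_congr rfl fun j _ => ?_
  simp only [Matrix.sub_apply, Matrix.smul_apply, smul_eq_mul]
  ring

lemma dFS_eq_sqrt {n : ℕ} (M S : Matrix (Fin n) (Fin n) ℝ) :
    dFS M S = √(1 - frobInner M S ^ 2 / (frobInner M M * frobInner S S)) := by
  rw [dFS, Real.sin_arccos, div_pow, mul_pow, sq_abs, frobNorm, frobNorm, ← frobInner_self,
    ← frobInner_self, Real.sq_sqrt (frobInner_self_nonneg M),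
    Real.sq_sqrt (frobInner_self_nonneg S)]

lemma dotProduct_gramShift_mulVec {n : ℕ} (c : ℝ) (M : Matrix (Fin n) (Fin n) ℝ) (v : Fin n → ℝ) :
    v ⬝ᵥ ((gramShift c M) *ᵥ v) = (M *ᵥ v) ⬝ᵥ (M *ᵥ v) - c * frobInner M M * (v ⬝ᵥ v) := by
  rw [gramShift, Matrix.sub_mulVec, dotProduct_sub, ← Matrix.mulVec_mulVec,
    Matrix.dotProduct_mulVec v, Matrix.vecMul_transpose, ← frobInner_self]
  congr 1
  simp only [dotProduct, Matrix.mulVec_diagonal, Finset.mul_sum]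
  exact Finset.sum_congr rfl fun i _ => by ring

lemma isHermitian_gramShift {n : ℕ} (c : ℝ) (M : Matrix (Fin n) (Fin n) ℝ) :
    (gramShift c M).IsHermitian := by
  rw [Matrix.IsHermitian, Matrix.conjTranspose_eq_transpose_of_trivial]
  simp [gramShift]

lemma isCompact_dotProduct_self_eq_one (n : ℕ) : IsCompact {v : Fin n → ℝ | v ⬝ᵥ v = 1} := by
  refine isCompact_Icc (a := fun _ => (-1 : ℝ)) (b := fun _ => 1) |>.of_isClosed_subset ?_ ?_
  · exact isClosed_eq (by fun_prop) continuous_const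
  · intro v hv
    have h : ∀ i, v i ^ 2 ≤ 1 := fun i => by
      rw [← (show v ⬝ᵥ v = 1 from hv), dotProduct, sq]
      exact Finset.single_le_sum (f := fun i => v i * v i)
        (fun i _ => mul_self_nonneg _) (Finset.mem_univ i)
    exact ⟨fun i => (abs_le.1 (abs_le_one_iff_mul_self_le_one.2 (by simpa [sq] using h i))).1,
      fun i => (abs_le.1 (abs_le_one_iff_mul_self_le_one.2 (by simpa [sq] using h i))).2⟩

/-- Every nonzero vector is a multiple of a unit vector. -/
lemma exists_unit_smul {n : ℕ} {v : Fin n → ℝ} (hv : v ≠ 0) :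
    ∃ (a : ℝ) (w : Fin n → ℝ), w ⬝ᵥ w = 1 ∧ v = a • w ∧ w = a⁻¹ • v := by
  have hpos : 0 < v ⬝ᵥ v := by
    have := (Matrix.dotProduct_star_self_pos_iff (v := v)).2 hv
    simpa using this
  have hne : √(v ⬝ᵥ v) ≠ 0 := (Real.sqrt_pos.2 hpos).ne'
  refine ⟨√(v ⬝ᵥ v), (√(v ⬝ᵥ v))⁻¹ • v, ?_, ?_, rfl⟩
  · rw [smul_dotProduct, dotProduct_smul, smul_eq_mul, smul_eq_mul, ← mul_assoc, ← mul_inv,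
      Real.mul_self_sqrt hpos.le, inv_mul_cancel₀ hpos.ne']
  · rw [smul_inv_smul₀ hne]

lemma not_posDef_gramShift_iff {n : ℕ} (c : ℝ) (M : Matrix (Fin n) (Fin n) ℝ) :
    ¬ (gramShift c M).PosDef ↔
      ∃ v : Fin n → ℝ, v ⬝ᵥ v = 1 ∧ (M *ᵥ v) ⬝ᵥ (M *ᵥ v) ≤ c * frobInner M M := by
  constructor
  · intro h
    by_contra! hcon
    refine h (Matrix.PosDef.of_dotProduct_mulVec_pos (isHermitian_gramShift c M) fun v hv => ?_)
    obtain ⟨a, w, hw, rfl, -⟩ := exists_unit_smul hv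
    have ha : a ≠ 0 := by rintro rfl; simp at hv
    have hw' := hcon w hw
    rw [star_trivial, Matrix.mulVec_smul, smul_dotProduct, dotProduct_smul,
      dotProduct_gramShift_mulVec, hw, smul_eq_mul, smul_eq_mul, ← mul_assoc]
    exact mul_pos (mul_self_pos.2 ha) (by linarith)
  · rintro ⟨v, hv, hle⟩ hpos
    have hv0 : v ≠ 0 := by rintro rfl; simp at hv
    have := hpos.dotProduct_mulVec_pos hv0
    rw [star_trivial, dotProduct_gramShift_mulVec, hv] at this
    linarith

lemma isClosed_not_posDef_gramShift {n : ℕ} (c : ℝ) :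
    IsClosed {M : Matrix (Fin n) (Fin n) ℝ | ¬ (gramShift c M).PosDef} := by
  have : CompactSpace {v : Fin n → ℝ | v ⬝ᵥ v = 1} :=
    isCompact_iff_compactSpace.1 (isCompact_dotProduct_self_eq_one n)
  have hcl : IsClosed {p : Matrix (Fin n) (Fin n) ℝ × {v : Fin n → ℝ | v ⬝ᵥ v = 1} |
      (p.1 *ᵥ p.2.1) ⬝ᵥ (p.1 *ᵥ p.2.1) ≤ c * frobInner p.1 p.1} := by
    refine isClosed_le ?_ ?_
    · fun_prop
    · unfold frobInner
      fun_prop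
  convert isClosedMap_fst_of_compactSpace _ hcl using 1
  ext M
  simp only [not_posDef_gramShift_iff]
  constructor
  · rintro ⟨v, hv, h⟩
    exact ⟨(M, ⟨v, hv⟩), h, rfl⟩
  · rintro ⟨⟨M', v⟩, h, rfl⟩
    exact ⟨v.1, v.2, h⟩

lemma mulVec_dotProduct_self_le {n : ℕ} (M : Matrix (Fin n) (Fin n) ℝ) {v : Fin n → ℝ}
    (hv : v ⬝ᵥ v = 1) : (M *ᵥ v) ⬝ᵥ (M *ᵥ v) ≤ frobInner M M := by
  rw [frobInner_self, dotProduct]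
  refine Finset.sum_le_sum fun i _ => ?_
  have h := Finset.sum_mul_sq_le_sq_mul_sq Finset.univ (M i) v
  have hv' : ∑ j, v j ^ 2 = 1 := by simpa [dotProduct, sq] using hv
  rw [hv', mul_one] at h
  simpa [Matrix.mulVec, dotProduct, sq] using h

/-- A lower bound for the distance of `M` to a singular matrix. -/
lemma exists_unit_mulVec_le_dFS {n : ℕ} {M S : Matrix (Fin n) (Fin n) ℝ} (hM : M ≠ 0) (hS : S ≠ 0)
    (hdet : ¬ IsUnit S.det) :
    ∃ v : Fin n → ℝ, v ⬝ᵥ v = 1 ∧ √((M *ᵥ v) ⬝ᵥ (M *ᵥ v) / frobInner M M) ≤ dFS M S := by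
  obtain ⟨v, hv, hSv⟩ := Matrix.exists_mulVec_eq_zero_iff.2 (by simpa using hdet : S.det = 0)
  obtain ⟨a, w, hw, -, rfl⟩ := exists_unit_smul hv
  refine ⟨_, hw, ?_⟩
  rw [dFS_eq_sqrt]
  refine Real.sqrt_le_sqrt ?_
  have hMp := frobInner_self_pos hM
  have hSp := frobInner_self_pos hS
  have hle := mulVec_dotProduct_self_le (M - (frobInner M S / frobInner S S) • S) hw
  rw [Matrix.sub_mulVec, Matrix.smul_mulVec, Matrix.mulVec_smul S, hSv, smul_zero, smul_zero,
    sub_zero, frobInner_sub_smul_self] at hle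
  rw [div_le_iff₀ hMp]
  refine hle.trans_eq ?_
  field_simp
  ring

lemma rhoSing_le_dFS {n : ℕ} (M : Matrix (Fin n) (Fin n) ℝ) {S : Matrix (Fin n) (Fin n) ℝ}
    (hS : S ≠ 0) (hdet : ¬ IsUnit S.det) : rhoSing M ≤ dFS M S := by
  refine csInf_le ⟨0, ?_⟩ ⟨S, hS, hdet, rfl⟩
  rintro _ ⟨S, -, -, rfl⟩
  rw [dFS_eq_sqrt]
  exact Real.sqrt_nonneg _

lemma not_isUnit_det_of_mulVec_eq_zero {n : ℕ} {S : Matrix (Fin n) (Fin n) ℝ} {v : Fin n → ℝ}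
    (hv : v ≠ 0) (hSv : S *ᵥ v = 0) : ¬ IsUnit S.det := by
  simpa using Matrix.exists_mulVec_eq_zero_iff.1 ⟨v, hv, hSv⟩

/-- A matrix of the form `u vᵀ` of size at least two is singular. -/
lemma not_isUnit_det_vecMulVec {n : ℕ} (hn : 2 ≤ n) (u v : Fin n → ℝ) :
    ¬ IsUnit (Matrix.vecMulVec u v).det := by
  have : Nontrivial (Fin n) := Fin.nontrivial_iff_two_le.2 hn
  simp [Matrix.det_vecMulVec]

lemma rhoSing_le_of_unit {n : ℕ} (hn : 2 ≤ n) {M : Matrix (Fin n) (Fin n) ℝ} (hM : M ≠ 0)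
    {v : Fin n → ℝ} (hv : v ⬝ᵥ v = 1) :
    rhoSing M ≤ √((M *ᵥ v) ⬝ᵥ (M *ᵥ v) / frobInner M M) := by
  have hMp := frobInner_self_pos hM
  set V := Matrix.vecMulVec (M *ᵥ v) v with hV
  by_cases hS : M - V = 0
  · have hMV : M = V := sub_eq_zero.1 hS
    refine (rhoSing_le_dFS M hM (hMV ▸ not_isUnit_det_vecMulVec hn _ _)).trans ?_
    rw [dFS_eq_sqrt, ← sq, div_self (by positivity), sub_self, Real.sqrt_zero]
    exact Real.sqrt_nonneg _
  · have hv0 : v ≠ 0 := by rintro rfl; simp at hv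
    have hVv : V *ᵥ v = M *ᵥ v := by
      rw [hV, Matrix.vecMulVec_mulVec, hv]
      simp
    have hSv : (M - V) *ᵥ v = 0 := by rw [Matrix.sub_mulVec, hVv, sub_self]
    refine (rhoSing_le_dFS M hS (not_isUnit_det_of_mulVec_eq_zero hv0 hSv)).trans ?_
    rw [dFS_eq_sqrt]
    refine Real.sqrt_le_sqrt (le_of_eq ?_)
    have hMV : frobInner M V = (M *ᵥ v) ⬝ᵥ (M *ᵥ v) := by
      simp only [frobInner, hV, Matrix.vecMulVec_apply, dotProduct]
      refine Finset.sum_congr rfl fun i _ => ?_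
      conv_rhs => rw [Matrix.mulVec, dotProduct, Finset.sum_mul]
      exact Finset.sum_congr rfl fun j _ => by rw [Matrix.mulVec, dotProduct]; ring
    have hVV : frobInner V V = (M *ᵥ v) ⬝ᵥ (M *ᵥ v) := by
      calc frobInner V V = ((M *ᵥ v) ⬝ᵥ (M *ᵥ v)) * (v ⬝ᵥ v) := by
            simp only [frobInner, hV, Matrix.vecMulVec_apply, dotProduct, Finset.sum_mul_sum]
            exact Finset.sum_congr rfl fun i _ => Finset.sum_congr rfl fun j _ => by ring
        _ = _ := by rw [hv, mul_one]
    have hMS : frobInner M (M - V) = frobInner M M - (M *ᵥ v) ⬝ᵥ (M *ᵥ v) := by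
      rw [← hMV]
      simp only [frobInner, Matrix.sub_apply, mul_sub, Finset.sum_sub_distrib]
    have hSS : frobInner (M - V) (M - V) = frobInner M M - (M *ᵥ v) ⬝ᵥ (M *ᵥ v) := by
      have := frobInner_sub_smul_self M V 1
      rw [one_smul, hMV, hVV] at this
      rw [this]
      ring
    have hSp := frobInner_self_pos hS
    rw [hSS] at hSp
    rw [hMS, hSS]
    field_simp
    ring

lemma rhoSing_le_iff {n : ℕ} (hn : 2 ≤ n) {M : Matrix (Fin n) (Fin n) ℝ} (hM : M ≠ 0) {ε : ℝ}
    (hε : 0 < ε) : rhoSing M ≤ ε ↔ ¬ (gramShift (ε ^ 2) M).PosDef := by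
  have hMp := frobInner_self_pos hM
  have : NeZero n := ⟨by omega⟩
  rw [not_posDef_gramShift_iff]
  constructor
  · intro hρ
    by_contra! hcon
    obtain ⟨w, hw, hmin⟩ := (isCompact_dotProduct_self_eq_one n).exists_isMinOn
      ⟨Pi.single 0 1, by simp⟩
      (f := fun v => (M *ᵥ v) ⬝ᵥ (M *ᵥ v)) (Continuous.continuousOn (by fun_prop))
    have hlt : ε < √((M *ᵥ w) ⬝ᵥ (M *ᵥ w) / frobInner M M) :=
      Real.lt_sqrt_of_sq_lt ((lt_div_iff₀ hMp).2 (hcon w hw))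
    refine (hlt.trans_le (le_csInf ?_ ?_)).not_ge hρ
    · refine ⟨_, Matrix.vecMulVec (Pi.single 0 1) (Pi.single 0 1), fun h => ?_,
        not_isUnit_det_vecMulVec hn _ _, rfl⟩
      simpa [Matrix.vecMulVec_apply] using congrFun (congrFun h 0) 0
    · rintro _ ⟨S, hS, hdet, rfl⟩
      obtain ⟨v, hv, hle⟩ := exists_unit_mulVec_le_dFS hM hS hdet
      refine le_trans (Real.sqrt_le_sqrt ?_) hle
      exact div_le_div_of_nonneg_right (hmin hv) hMp.le
  · rintro ⟨v, hv, hle⟩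
    refine (rhoSing_le_of_unit hn hM hv).trans ?_
    rw [Real.sqrt_le_left hε.le, div_le_iff₀ hMp]
    exact hle

lemma mem_Rset_iff {n : ℕ} (hn : 2 ≤ n) {ε H : ℝ} (hε : 0 < ε) (hH : 0 ≤ H)
    (M : Matrix (Fin n) (Fin n) ℝ) :
    M ∈ Rset n ε H ↔ frobInner M M - H ^ 2 ≤ 0 ∧ ¬ (gramShift (ε ^ 2) M).PosDef := by
  have hnorm : frobNorm M ≤ H ↔ frobInner M M - H ^ 2 ≤ 0 := by
    rw [frobNorm, Real.sqrt_le_left hH, ← frobInner_self, sub_nonpos]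
  have : NeZero n := ⟨by omega⟩
  rcases eq_or_ne M 0 with rfl | hM
  · have : ¬ (gramShift (ε ^ 2) (0 : Matrix (Fin n) (Fin n) ℝ)).PosDef :=
      (not_posDef_gramShift_iff _ _).2 ⟨Pi.single 0 1, by simp, by
        rw [Matrix.zero_mulVec]; simp [frobInner]⟩
    simp only [Rset, Set.mem_inter_iff, Set.mem_ofPred_eq, hnorm, true_or, this, not_false_eq_true]
  · simp only [Rset, Set.mem_inter_iff, Set.mem_ofPred_eq, hnorm, hM, false_or,
      rhoSing_le_iff hn hM hε]

lemma frontier_setOf_eval_nonpos_subset (p : Polynomial ℝ) :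
    frontier {t : ℝ | p.eval t ≤ 0} ⊆ p.roots.toFinset := by
  rcases eq_or_ne p 0 with rfl | hp
  · simp
  · intro t ht
    have : p.eval t = 0 := frontier_le_subset_eq p.continuous continuous_const ht
    simpa [hp] using this

lemma natDegree_det_le {n d : ℕ} {A : Matrix (Fin n) (Fin n) (Polynomial ℝ)}
    (hA : ∀ i j, (A i j).natDegree ≤ d) : A.det.natDegree ≤ n * d := by
  rw [Matrix.det_apply]
  refine Polynomial.natDegree_sum_le_of_forall_le _ _ fun σ _ => ?_
  refine (Polynomial.natDegree_smul_le _ _).trans ((Polynomial.natDegree_prod_le _ _).trans ?_)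
  exact (Finset.sum_le_sum fun i _ => hA _ _).trans (by simp)

lemma natDegree_sum_sq_le {n : ℕ} {P : Matrix (Fin n) (Fin n) (Polynomial ℝ)}
    (hP : ∀ i j, (P i j).natDegree ≤ 1) : (∑ i, ∑ j, P i j ^ 2).natDegree ≤ 2 :=
  Polynomial.natDegree_sum_le_of_forall_le _ _ fun i _ =>
    Polynomial.natDegree_sum_le_of_forall_le _ _ fun j _ =>
      Polynomial.natDegree_pow_le_of_le 2 (hP i j)

lemma natDegree_gramShift_le {n : ℕ} {P : Matrix (Fin n) (Fin n) (Polynomial ℝ)}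
    (hP : ∀ i j, (P i j).natDegree ≤ 1) (c : ℝ) (i j : Fin n) :
    (gramShift (Polynomial.C c) P i j).natDegree ≤ 2 := by
  rw [gramShift, Matrix.sub_apply]
  refine (Polynomial.natDegree_sub_le _ _).trans (max_le ?_ ?_)
  · rw [Matrix.mul_apply]
    exact Polynomial.natDegree_sum_le_of_forall_le _ _ fun k _ =>
      Polynomial.natDegree_mul_le_of_le (hP k i) (hP k j)
  · rw [Matrix.diagonal_apply]
    split_ifs
    · exact (Polynomial.natDegree_C_mul_le _ _).trans (natDegree_sum_sq_le hP)
    · simp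

lemma eval_gramShift {n : ℕ} (P : Matrix (Fin n) (Fin n) (Polynomial ℝ)) (c t : ℝ) :
    (gramShift (Polynomial.C c) P).map (Polynomial.eval t) =
      gramShift c (P.map (Polynomial.eval t)) := by
  ext i j
  simp only [gramShift, Matrix.map_apply, Matrix.sub_apply, Matrix.mul_apply, Matrix.diagonal_apply,
    Matrix.transpose_apply, Polynomial.eval_sub, Polynomial.eval_finsetSum, Polynomial.eval_mul]
  split_ifs <;> simp [Polynomial.eval_finsetSum]

lemma eval_det_gramShift {n : ℕ} (P : Matrix (Fin n) (Fin n) (Polynomial ℝ)) (c t : ℝ) :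
    (gramShift (Polynomial.C c) P).det.eval t =
      (gramShift c (P.map (Polynomial.eval t))).det := by
  rw [← eval_gramShift]
  exact (Polynomial.evalRingHom t).map_det _

lemma continuous_map_eval {n : ℕ} (P : Matrix (Fin n) (Fin n) (Polynomial ℝ)) :
    Continuous fun t : ℝ => P.map (Polynomial.eval t) :=
  continuous_matrix fun i j => (P i j).continuous

lemma frontier_not_posDef_gramShift_subset {n : ℕ} (P : Matrix (Fin n) (Fin n) (Polynomial ℝ))
    (c : ℝ) :
    frontier {t : ℝ | ¬ (gramShift c (P.map (Polynomial.eval t))).PosDef} ⊆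
      (gramShift (Polynomial.C c) P).det.roots.toFinset := by
  set D := {t : ℝ | ¬ (gramShift c (P.map (Polynomial.eval t))).PosDef} with hD
  have hclosed : IsClosed D := (isClosed_not_posDef_gramShift c).preimage (continuous_map_eval P)
  by_cases hdet : (gramShift (Polynomial.C c) P).det = 0
  · have : D = Set.univ := Set.eq_univ_of_forall fun t hpos => by
      have h := hpos.det_pos
      rw [← eval_det_gramShift, hdet] at h
      simp at h
    rw [this]
    simp
  · intro t ht
    have htD : t ∈ D := hclosed.frontier_subset ht
    have htc : t ∈ closure Dᶜ := by
      rw [frontier_eq_closure_inter_closure] at ht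
      exact ht.2
    have hpsd : (gramShift c (P.map (Polynomial.eval t))).PosSemidef := by
      refine Matrix.PosSemidef.of_dotProduct_mulVec_nonneg (isHermitian_gramShift _ _) fun v => ?_
      have hcl : IsClosed {s : ℝ | 0 ≤ star v ⬝ᵥ (gramShift c (P.map (Polynomial.eval s)) *ᵥ v)} := by
        refine isClosed_le continuous_const ?_
        have := continuous_map_eval P
        simp only [star_trivial, dotProduct_gramShift_mulVec]
        unfold frobInner
        fun_prop
      refine closure_minimal ?_ hcl htc
      intro s hs
      exact (not_not.1 hs).posSemidef.dotProduct_mulVec_nonneg v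
    have hroot : (gramShift (Polynomial.C c) P).det.eval t = 0 := by
      rw [eval_det_gramShift]
      by_contra hne
      exact htD (hpsd.posDef_iff_isUnit.2
        ((Matrix.isUnit_iff_isUnit_det _).2 (isUnit_iff_ne_zero.2 hne)))
    simpa [hdet] using hroot

lemma exists_frontier_Rset_subset {n : ℕ} (hn : 2 ≤ n) {ε H : ℝ} (hε : 0 < ε) (hH : 0 ≤ H)
    {P : Matrix (Fin n) (Fin n) (Polynomial ℝ)} (hP : ∀ i j, (P i j).natDegree ≤ 1) :
    ∃ F : Finset ℝ, F.card ≤ 2 * n + 2 ∧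
      frontier {t : ℝ | P.map (Polynomial.eval t) ∈ Rset n ε H} ⊆ F := by
  set p : Polynomial ℝ := ∑ i, ∑ j, P i j ^ 2 - Polynomial.C (H ^ 2) with hp
  set q := (gramShift (Polynomial.C (ε ^ 2)) P).det with hq
  have hpeval : ∀ t, frobInner (P.map (Polynomial.eval t)) (P.map (Polynomial.eval t)) - H ^ 2 =
      p.eval t := fun t => by
    simp [hp, frobInner_self, Polynomial.eval_finsetSum]
  refine ⟨p.roots.toFinset ∪ q.roots.toFinset, ?_, ?_⟩
  · have h₁ : p.roots.toFinset.card ≤ 2 :=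
      (Multiset.toFinset_card_le _).trans ((Polynomial.card_roots' p).trans
        ((Polynomial.natDegree_sub_le _ _).trans (max_le (natDegree_sum_sq_le hP) (by simp))))
    have h₂ : q.roots.toFinset.card ≤ n * 2 :=
      (Multiset.toFinset_card_le _).trans ((Polynomial.card_roots' q).trans
        (natDegree_det_le (natDegree_gramShift_le hP _)))
    exact (Finset.card_union_le _ _).trans (by omega)
  · have hset : {t : ℝ | P.map (Polynomial.eval t) ∈ Rset n ε H} =
        {t | p.eval t ≤ 0} ∩ {t | ¬ (gramShift (ε ^ 2) (P.map (Polynomial.eval t))).PosDef} := by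
      ext t
      simp only [mem_Rset_iff hn hε hH, hpeval]
      rfl
    rw [hset, Finset.coe_union]
    refine (frontier_inter_subset _ _).trans (Set.union_subset_union ?_ ?_)
    · exact Set.inter_subset_left.trans (frontier_setOf_eval_nonpos_subset p)
    · exact Set.inter_subset_right.trans (frontier_not_posDef_gramShift_subset P _)

lemma isClosed_Rset {n : ℕ} (hn : 2 ≤ n) {ε H : ℝ} (hε : 0 < ε) (hH : 0 ≤ H) :
    IsClosed (Rset n ε H) := by
  have : Rset n ε H = {M | frobInner M M - H ^ 2 ≤ 0} ∩ {M | ¬ (gramShift (ε ^ 2) M).PosDef} := by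
    ext M
    exact mem_Rset_iff hn hε hH M
  rw [this]
  refine IsClosed.inter (isClosed_le ?_ continuous_const) (isClosed_not_posDef_gramShift _)
  unfold frobInner
  fun_prop

/-- The matrix whose entries are listed by a vector. -/
def matrixOfVec {R : Type*} {n : ℕ} (x : Fin (n * n) → R) : Matrix (Fin n) (Fin n) R :=
  Matrix.of fun i j => x (finProdFinEquiv (i, j))

lemma matrixOfVec_injective {R : Type*} {n : ℕ} :
    Function.Injective (matrixOfVec : (Fin (n * n) → R) → Matrix (Fin n) (Fin n) R) := by
  intro x y hxy
  ext k
  obtain ⟨⟨i, j⟩, rfl⟩ := finProdFinEquiv.surjective k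
  exact congrFun (congrFun hxy i) j

lemma measurePreserving_vec_of_matrix (n : ℕ) :
    MeasurePreserving (fun (M : Fin n → Fin n → ℝ) (k : Fin (n * n)) =>
      M (finProdFinEquiv.symm k).1 (finProdFinEquiv.symm k).2) := by
  have hmeas : Measurable (fun (M : Fin n → Fin n → ℝ) (k : Fin (n * n)) =>
      M (finProdFinEquiv.symm k).1 (finProdFinEquiv.symm k).2) := by fun_prop
  refine ⟨hmeas, (Measure.pi_eq fun s hs => ?_).symm⟩
  rw [Measure.map_apply hmeas (MeasurableSet.univ_pi hs)]
  have hpre : (fun (M : Fin n → Fin n → ℝ) (k : Fin (n * n)) =>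
      M (finProdFinEquiv.symm k).1 (finProdFinEquiv.symm k).2) ⁻¹' Set.univ.pi s =
      Set.univ.pi fun i => Set.univ.pi fun j => s (finProdFinEquiv (i, j)) := by
    ext M
    simp only [Set.mem_preimage, Set.mem_univ_pi]
    constructor
    · intro h i j
      simpa using h (finProdFinEquiv (i, j))
    · intro h k
      have := h (finProdFinEquiv.symm k).1 (finProdFinEquiv.symm k).2
      rwa [Prod.mk.eta, Equiv.apply_symm_apply] at this
  rw [hpre, volume_pi_pi, ← Equiv.prod_comp finProdFinEquiv, Fintype.prod_prod_type]
  simp only [volume_pi_pi]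

lemma volume_Rset_eq {n : ℕ} {ε H : ℝ}
    (hR : MeasurableSet (matrixOfVec ⁻¹' Rset n ε H : Set (Fin (n * n) → ℝ))) :
    (volume (Rset n ε H)).toReal = volume.real (matrixOfVec ⁻¹' Rset n ε H) := by
  rw [measureReal_def, ← (measurePreserving_vec_of_matrix n).measure_preimage hR.nullMeasurableSet]
  congr 2
  ext M
  have : matrixOfVec (fun k => M (finProdFinEquiv.symm k).1 (finProdFinEquiv.symm k).2) = M := by
    ext i j
    simp [matrixOfVec]
  change M ∈ Rset n ε H ↔ matrixOfVec _ ∈ Rset n ε H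
  rw [this]

lemma axisFrontierBound_Rset {n : ℕ} (hn : 2 ≤ n) {ε H : ℝ} (hε : 0 < ε) (hH : 0 ≤ H) :
    AxisFrontierBound (2 * n + 2) (matrixOfVec ⁻¹' Rset n ε H) := by
  intro x k
  have hP : ∀ i j, (matrixOfVec (Function.update (fun l => Polynomial.C (x l)) k Polynomial.X)
      i j).natDegree ≤ 1 := by
    intro i j
    simp only [matrixOfVec, Matrix.of_apply, Function.update_apply]
    split_ifs <;> simp
  obtain ⟨F, hFc, hF⟩ := exists_frontier_Rset_subset hn hε hH hP
  refine ⟨F, hFc, ?_⟩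
  have : ∀ t : ℝ, (matrixOfVec (Function.update (fun l => Polynomial.C (x l)) k
      Polynomial.X)).map (Polynomial.eval t) = matrixOfVec (Function.update x k t) := by
    intro t
    ext i j
    simp only [matrixOfVec, Matrix.map_apply, Matrix.of_apply, Function.update_apply]
    split_ifs <;> simp
  simp only [this] at hF
  exact hF

lemma abs_apply_le_of_mem_Rset {n : ℕ} {ε H : ℝ} {M : Matrix (Fin n) (Fin n) ℝ}
    (hM : M ∈ Rset n ε H) (i j : Fin n) : |M i j| ≤ H := by
  refine le_trans (Real.abs_le_sqrt ?_) hM.1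
  refine (Finset.single_le_sum (f := fun j => M i j ^ 2) (fun _ _ => by positivity)
    (Finset.mem_univ j)).trans ?_
  exact Finset.single_le_sum (f := fun i => ∑ j, M i j ^ 2) (fun _ _ => by positivity)
    (Finset.mem_univ i)

lemma floor_mem_of_mem_Rset {n : ℕ} {ε H : ℝ} {x : Fin (n * n) → ℝ}
    (hx : x ∈ matrixOfVec ⁻¹' Rset n ε H) (k : Fin (n * n)) :
    ⌊x k⌋ ∈ Finset.Icc ⌊-H⌋ ⌊H⌋ := by
  obtain ⟨⟨i, j⟩, rfl⟩ := finProdFinEquiv.surjective k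
  have h := abs_le.1 (abs_apply_le_of_mem_Rset hx i j)
  exact Finset.mem_Icc.2 ⟨Int.floor_le_floor h.1, Int.floor_le_floor h.2⟩

lemma ncard_integer_points_Rset (n : ℕ) (ε H : ℝ) :
    (Set.ncard {M ∈ Rset n ε H | ∀ i j, ∃ z : ℤ, M i j = (z : ℝ)} : ℝ) =
      ∑ z ∈ Fintype.piFinset (fun _ : Fin (n * n) => Finset.Icc ⌊-H⌋ ⌊H⌋),
        (matrixOfVec ⁻¹' Rset n ε H).indicator (1 : (Fin (n * n) → ℝ) → ℝ)
          (fun i => (z i : ℝ)) := by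
  classical
  have hinj : Function.Injective fun z : Fin (n * n) → ℤ => matrixOfVec fun i => (z i : ℝ) := by
    intro z w h
    ext i
    exact_mod_cast congrFun (matrixOfVec_injective h) i
  have hset : {M ∈ Rset n ε H | ∀ i j, ∃ z : ℤ, M i j = (z : ℝ)} =
      (fun z : Fin (n * n) → ℤ => matrixOfVec fun i => (z i : ℝ)) ''
        ((Fintype.piFinset (fun _ : Fin (n * n) => Finset.Icc ⌊-H⌋ ⌊H⌋)).filter
          fun z => (fun i => (z i : ℝ)) ∈ matrixOfVec ⁻¹' Rset n ε H : Finset _) := by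
    ext M
    simp only [Finset.coe_filter, Fintype.mem_piFinset]
    constructor
    · rintro ⟨hM, hint⟩
      choose Z hZ using hint
      have hMZ : (matrixOfVec fun k => (Z (finProdFinEquiv.symm k).1
          (finProdFinEquiv.symm k).2 : ℝ)) = M := by
        ext i j
        simp [matrixOfVec, hZ]
      refine ⟨fun k => Z (finProdFinEquiv.symm k).1 (finProdFinEquiv.symm k).2, ⟨fun k => ?_, ?_⟩,
        hMZ⟩
      · have := floor_mem_of_mem_Rset (x := fun k => (Z (finProdFinEquiv.symm k).1
          (finProdFinEquiv.symm k).2 : ℝ)) (by rwa [Set.mem_preimage, hMZ]) k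
        simpa only [Int.floor_intCast] using this
      · rwa [Set.mem_preimage, hMZ]
    · rintro ⟨z, ⟨-, hz⟩, rfl⟩
      exact ⟨hz, fun i j => ⟨z (finProdFinEquiv (i, j)), rfl⟩⟩
  rw [hset, Set.ncard_image_of_injective _ hinj, Set.ncard_coe_finset, Finset.card_filter]
  push_cast
  exact Finset.sum_congr rfl fun z _ => by simp [Set.indicator_apply]

lemma one_le_Sfrak {m : ℕ} (hm : 1 ≤ m) : 1 ≤ Sfrak m := by
  have h0 : ((m.choose 0 : ℕ) : ℝ) * Kvol 0 = 1 := by simp [Kvol]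
  rw [← h0, Sfrak]
  refine Finset.single_le_sum (f := fun ℓ => (m.choose ℓ : ℝ) * Kvol ℓ) (fun ℓ _ => ?_)
    (Finset.mem_range.2 hm)
  have := Real.Gamma_pos_of_pos (show (0 : ℝ) < (ℓ : ℝ) / 2 + 1 by positivity)
  have := Real.pi_pos
  unfold Kvol
  positivity

lemma const_le_Tconst {n : ℕ} (hn : 2 ≤ n) :
    ((n * n : ℕ) : ℝ) * ((2 * n + 2 : ℕ) : ℝ) * 4 ^ (n ^ 2 - 1) ≤ Tconst n := by
  rw [Tconst]
  norm_cast
  set a := 2 * max 4 n with ha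
  have h4 : 8 ≤ a := by have := le_max_left 4 n; omega
  have h2n : 2 * n ≤ a := by have := le_max_right 4 n; omega
  have hsq : 1 ≤ n ^ 2 := Nat.one_le_pow _ _ (by omega)
  calc n * n * (2 * n + 2) * 4 ^ (n ^ 2 - 1)
      ≤ a * a * (a * a) * a ^ (n ^ 2 - 1) := by
        gcongr
        · omega
        · omega
        · nlinarith
        · omega
    _ = a ^ (n ^ 2 - 1 + 4) := by ring
    _ ≤ a ^ (2 * n ^ 4 + 4 * n ^ 2) := Nat.pow_le_pow_right (by omega) (by omega)

/-- Davenport's discrepancy in the Linear Algebra case: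
`|N(ε,H) − Vol(R(ε,H))| ≤ T_n · 𝔖^{(n²)} · H^{n²−1}`. -/
theorem integer_points_discrepancy_Rset
    {n : ℕ} (hn : 2 ≤ n) (H ε : ℝ) (hH : 1 ≤ H) (hε : 0 < ε) :
    |(Set.ncard {M ∈ Rset n ε H | ∀ i j, ∃ z : ℤ, M i j = (z : ℝ)} : ℝ) -
        (volume (Rset n ε H)).toReal| ≤
      Tconst n * Sfrak (n ^ 2) * H ^ (n ^ 2 - 1) := by
  have hH0 : 0 ≤ H := by linarith
  have hmeas : MeasurableSet (matrixOfVec ⁻¹' Rset n ε H : Set (Fin (n * n) → ℝ)) := by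
    refine ((isClosed_Rset hn hε hH0).preimage ?_).measurableSet
    exact continuous_matrix fun i j => continuous_apply _
  have hcard : ((Finset.Icc ⌊-H⌋ ⌊H⌋).card : ℝ) ≤ 4 * H := by
    have h₁ := Int.floor_le H
    have h₂ := Int.lt_floor_add_one (-H)
    have h₃ : (0 : ℤ) ≤ ⌊H⌋ + 1 - ⌊-H⌋ := by
      have := Int.floor_le_floor (show -H ≤ H by linarith)
      omega
    have h₄ : ((Finset.Icc ⌊-H⌋ ⌊H⌋).card : ℝ) = ⌊H⌋ + 1 - ⌊-H⌋ := by
      rw [Int.card_Icc]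
      exact_mod_cast Int.toNat_of_nonneg h₃
    rw [h₄]
    linarith
  rw [ncard_integer_points_Rset, volume_Rset_eq hmeas]
  refine (abs_sum_indicator_sub_volume_le_of_axisFrontierBound hmeas
    (fun x hx k => floor_mem_of_mem_Rset hx k) (axisFrontierBound_Rset hn hε hH0)).trans ?_
  have hT := const_le_Tconst hn
  have hS := one_le_Sfrak (m := n ^ 2) (Nat.one_le_pow _ _ (by omega))
  calc _ ≤ ((n * n : ℕ) : ℝ) * ((2 * n + 2 : ℕ) : ℝ) * (4 * H) ^ (n * n - 1) := by gcongr
    _ = ((n * n : ℕ) : ℝ) * ((2 * n + 2 : ℕ) : ℝ) * 4 ^ (n ^ 2 - 1) * 1 * H ^ (n ^ 2 - 1) := by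
        rw [← sq n, mul_pow]
        ring
    _ ≤ Tconst n * Sfrak (n ^ 2) * H ^ (n ^ 2 - 1) := by
        have : 0 ≤ Tconst n := le_trans (by positivity) hT
        gcongr

end
end
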